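/- Let k ≥ 2 and r ≥ 0 be integers and let G be a 2-connected graph with minimum degree at least k−r. If there is an even integer ℓ such that G contains no (ℓ mod k)-cycle, then every vertex cut S of G satisfies 2|S| ≥ k+2−2r; that is, the connectivity of G is at least (k+2)/2 − r. -/

import Mathlib

open SimpleGraph

/-- `G` has a cycle of length `n`. -/
def HasCycleLen {V : Type*} (G : SimpleGraph V) (n : ℕ) : Prop :=
  ∃ (v : V) (c : G.Walk v v), c.IsCycle ∧ c.length = n

/-- `G` has a cycle whose length is congruent to `l` modulo `k`. -/
def HasCycleLenMod {V : Type*} (G : SimpleGraph V) (k : ℕ) (l : ℤ) : Prop :=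
  ∃ n : ℕ, HasCycleLen G n ∧ (n : ℤ) ≡ l [ZMOD (k : ℤ)]

/-- `G` is `t`-connected: it has at least `t+1` vertices and the deletion of any set
of at most `t-1` vertices leaves a connected graph. -/
def KConnected {V : Type*} [Fintype V] (G : SimpleGraph V) (t : ℕ) : Prop :=
  t + 1 ≤ Fintype.card V ∧
    ∀ S : Finset V, S.card ≤ t - 1 → (G.induce ((↑S : Set V)ᶜ)).Connected

/-- A finite set `S` of vertices is a vertex cut of `G` if deleting `S` leaves a
disconnected graph. -/
def IsVertexCut {V : Type*} (G : SimpleGraph V) (S : Finset V) : Prop :=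
  ¬ (G.induce ((↑S : Set V)ᶜ)).Connected

set_option linter.unusedSectionVars false

section Paths

variable {V : Type*} [DecidableEq V] (G : SimpleGraph V) [DecidableRel G.Adj]

/-- `PIn G U u v n`: there is a path with `n` edges from `u` to `v` inside `U`. -/
inductive PIn : Finset V → V → V → ℕ → Prop
  | nil {U : Finset V} {u : V} : u ∈ U → PIn U u u 0
  | cons {U : Finset V} {u w v : V} {n : ℕ} :
      u ∈ U → G.Adj u w → PIn (U.erase u) w v n → PIn U u v (n + 1)

variable {G}

theorem PIn.mem_left {U : Finset V} {u v : V} {n : ℕ} (h : PIn G U u v n) : u ∈ U := by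
  cases h <;> assumption

theorem PIn.mem_right {U : Finset V} {u v : V} {n : ℕ} (h : PIn G U u v n) : v ∈ U := by
  induction h with
  | nil h => exact h
  | cons _ _ _ ih => exact Finset.mem_of_mem_erase ih

theorem PIn.mono {U U' : Finset V} {u v : V} {n : ℕ} (h : PIn G U u v n) (hU : U ⊆ U') :
    PIn G U' u v n := by
  induction h generalizing U' with
  | nil h => exact .nil (hU h)
  | cons h a _ ih => exact .cons (hU h) a (ih (Finset.erase_subset_erase _ hU))

theorem PIn.join {U₁ U₂ U : Finset V} {u v w x : V} {n m : ℕ} (h₁ : PIn G U₁ u v n)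
    (hvw : G.Adj v w) (h₂ : PIn G U₂ w x m) (hd : Disjoint U₁ U₂) (s₁ : U₁ ⊆ U) (s₂ : U₂ ⊆ U) :
    PIn G U u x (n + m + 1) := by
  induction h₁ generalizing U with
  | @nil U₁ u h =>
    rw [Nat.zero_add]
    refine .cons (s₁ h) hvw (h₂.mono fun y hy => Finset.mem_erase.2 ⟨?_, s₂ hy⟩)
    rintro rfl
    exact Finset.disjoint_left.1 hd h hy
  | @cons U₁ u y v n h a _ ih =>
    have := ih hvw (U := U.erase u) (hd.mono_left (Finset.erase_subset _ _))
      (Finset.erase_subset_erase _ s₁) (fun z hz => Finset.mem_erase.2 ⟨by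
        rintro rfl; exact Finset.disjoint_left.1 hd h hz, s₂ hz⟩)
    rw [show n + 1 + m + 1 = (n + m + 1) + 1 by omega]
    exact .cons (s₁ h) a this

theorem PIn.symm {U : Finset V} {u v : V} {n : ℕ} (h : PIn G U u v n) : PIn G U v u n := by
  induction h with
  | nil h => exact .nil h
  | @cons U u w v n h a _ ih =>
    exact ih.join a.symm (.nil (Finset.mem_singleton_self u))
      (Finset.disjoint_singleton_right.2 (Finset.notMem_erase u U))
      (Finset.erase_subset _ _) (Finset.singleton_subset_iff.2 h)

theorem PIn.extend {U : Finset V} {u v w : V} {n : ℕ} (h : PIn G U u v n) (a : G.Adj v w)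
    (hw : w ∈ U) : ∃ m, PIn G U u w m := by
  induction h with
  | @nil U u h =>
    exact ⟨1, .cons h a (.nil (Finset.mem_erase.2 ⟨a.ne', hw⟩))⟩
  | @cons U u y v n h b _ ih =>
    by_cases e : w = u
    · subst e; exact ⟨0, .nil h⟩
    · obtain ⟨m, hm⟩ := ih a (Finset.mem_erase.2 ⟨e, hw⟩)
      exact ⟨m + 1, .cons h b hm⟩

theorem PIn.toWalk {U : Finset V} {u v : V} {n : ℕ} (h : PIn G U u v n) :
    ∃ p : G.Walk u v, p.IsPath ∧ p.length = n ∧ ∀ x ∈ p.support, x ∈ U := by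
  induction h with
  | nil h => exact ⟨.nil, by simp, rfl, by simpa using h⟩
  | @cons U u w v n h a _ ih =>
    obtain ⟨p, hp, hl, hs⟩ := ih
    refine ⟨.cons a p, ?_, by simp [hl], ?_⟩
    · rw [SimpleGraph.Walk.cons_isPath_iff]
      exact ⟨hp, fun hu => Finset.notMem_erase u U (hs u hu)⟩
    · intro x hx
      rw [SimpleGraph.Walk.support_cons, List.mem_cons] at hx
      rcases hx with rfl | hx
      · exact h
      · exact Finset.mem_of_mem_erase (hs x hx)

theorem PIn.hasCycleLen {U : Finset V} {u v w : V} {n : ℕ} (h : PIn G U u v n) (hn : 1 ≤ n)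
    (hw : w ∉ U) (hu : G.Adj w u) (hv : G.Adj v w) : HasCycleLen G (n + 2) := by
  obtain ⟨p, hp, hl, hs⟩ := h.toWalk
  refine ⟨w, .cons hu (p.concat hv), ?_, by simp [hl]⟩
  rw [SimpleGraph.Walk.cons_isCycle_iff]
  constructor
  · exact hp.concat (fun hx => hw (hs _ hx)) hv
  · rw [SimpleGraph.Walk.edges_concat, List.concat_eq_append, List.mem_append]
    rintro (h1 | h1)
    · exact hw (hs _ (p.fst_mem_support_of_mem_edges h1))
    · rw [List.mem_singleton, Sym2.eq_iff] at h1
      rcases h1 with ⟨rfl, _⟩ | ⟨_, rfl⟩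
      · exact hv.ne rfl
      · cases h with
        | nil => omega
        | cons h1 _ h2 => exact Finset.notMem_erase _ _ h2.mem_right

/-- the vertices with a neighbour in `T` -/
def nbs (G : SimpleGraph V) (T : Finset V) : Set V := {v | ∃ t ∈ T, G.Adj v t}

theorem mem_nbs_singleton {b v : V} : v ∈ nbs G {b} ↔ G.Adj v b := by simp [nbs]

end Paths

section Basics

variable {V : Type*} [DecidableEq V] (G : SimpleGraph V) [DecidableRel G.Adj]

/-- number of neighbours of `v` in `U` -/
def dg (U : Finset V) (v : V) : ℕ := (U.filter (G.Adj v ·)).card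

open Classical in
/-- indicator of a set of vertices -/
noncomputable def ind (A : Set V) (v : V) : ℕ := if v ∈ A then 1 else 0

/-- `D` is closed under taking neighbours inside `U`. -/
def Clo (U D : Finset V) : Prop := ∀ d ∈ D, ∀ u ∈ U, G.Adj d u → u ∈ D

/-- `D` is closed under taking neighbours inside `U`, except for `b`. -/
def CloX (U D : Finset V) (b : V) : Prop := ∀ d ∈ D, ∀ u ∈ U, G.Adj d u → u ∈ D ∨ u = b

/-- the finite set `D` meets the set `A` -/
def Meets (D : Finset V) (A : Set V) : Prop := ∃ d ∈ D, d ∈ A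

/-- `U` induces a connected (or empty) graph. -/
def Conn (U : Finset V) : Prop := ∀ D ⊆ U, D.Nonempty → Clo G U D → D = U

/-- the connectivity conditions on a part `U` with terminal sets `A` and `B` -/
structure Good (U : Finset V) (A B : Set V) : Prop where
  c1 : ∀ D ⊆ U, D.Nonempty → Clo G U D → Meets D A ∧ Meets D B
  c2 : ∀ b, ∀ D ⊆ U, D.Nonempty → b ∉ D → CloX G U D b → Meets D A ∨ Meets D B

/-- labelled lengths of the paths from `A` to `B` in `U` -/
def Val (U : Finset V) (A : Set V) (α : V → ℕ) (B : Set V) : Set ℕ :=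
  {n | ∃ a ∈ A, ∃ b ∈ B, ∃ l, PIn G U a b l ∧ n = α a + l}

/-- `X` contains an arithmetic progression of `k` terms with difference `1` or `2`. -/
def Adm (k : ℕ) (X : Set ℕ) : Prop := ∃ c d, (d = 1 ∨ d = 2) ∧ ∀ i < k, c + d * i ∈ X

variable {G}

theorem ind_of_mem {A : Set V} {v : V} (h : v ∈ A) : ind A v = 1 := if_pos h

theorem ind_of_notMem {A : Set V} {v : V} (h : v ∉ A) : ind A v = 0 := if_neg h

theorem ind_le_one (A : Set V) (v : V) : ind A v ≤ 1 := by
  unfold ind; split_ifs <;> omega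

theorem dg_mono {U W : Finset V} (h : U ⊆ W) (v : V) : dg G U v ≤ dg G W v :=
  Finset.card_le_card (Finset.filter_subset_filter _ h)

theorem dg_le_of {U W : Finset V} {v : V} (h : ∀ u ∈ U, G.Adj v u → u ∈ W) :
    dg G U v ≤ dg G W v :=
  Finset.card_le_card fun u hu => by
    rw [Finset.mem_filter] at hu ⊢
    exact ⟨h u hu.1 hu.2, hu.2⟩

theorem dg_le_add {U D W : Finset V} {v : V} (h : ∀ u ∈ U, G.Adj v u → u ∈ D ∨ u ∈ W) :
    dg G U v ≤ dg G D v + dg G W v := by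
  unfold dg
  refine (Finset.card_le_card fun u hu => ?_).trans (Finset.card_union_le _ _)
  simp only [Finset.mem_filter, Finset.mem_union] at hu ⊢
  rcases h u hu.1 hu.2 with h1 | h1
  · exact .inl ⟨h1, hu.2⟩
  · exact .inr ⟨h1, hu.2⟩

theorem dg_le_card (U : Finset V) (v : V) : dg G U v ≤ U.card := Finset.card_filter_le _ _

theorem dg_lt_card {U : Finset V} {u v : V} (hu : u ∈ U) (h : ¬ G.Adj v u) :
    dg G U v + 1 ≤ U.card :=
  Finset.card_lt_card (Finset.filter_ssubset.2 ⟨u, hu, h⟩)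

theorem dg_eq_zero {U : Finset V} {v : V} (h : ∀ u ∈ U, ¬ G.Adj v u) : dg G U v = 0 := by
  rw [dg, Finset.card_eq_zero, Finset.filter_eq_empty_iff]; exact h

theorem dg_singleton_le (b v : V) : dg G {b} v ≤ ind (nbs G {b}) v := by
  by_cases h : G.Adj v b
  · rw [ind_of_mem (mem_nbs_singleton.2 h)]; exact (dg_le_card _ _).trans (by simp)
  · rw [dg_eq_zero (by simpa using h)]; exact Nat.zero_le _

theorem dg_erase_le (U : Finset V) (b v : V) :
    dg G U v ≤ dg G (U.erase b) v + ind (nbs G {b}) v := by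
  refine (dg_le_add (D := U.erase b) (W := {b}) fun u hu _ => ?_).trans
    (Nat.add_le_add_left (dg_singleton_le b v) _)
  by_cases h : u = b
  · exact .inr (by simpa using h)
  · exact .inl (Finset.mem_erase.2 ⟨h, hu⟩)

theorem dg_erase_self (U : Finset V) (v : V) : dg G (U.erase v) v = dg G U v := by
  refine le_antisymm (dg_mono (Finset.erase_subset _ _) v) (dg_le_of fun u hu h => ?_)
  exact Finset.mem_erase.2 ⟨h.ne', hu⟩

theorem dg_union {U W : Finset V} (v : V) : dg G (U ∪ W) v ≤ dg G U v + dg G W v :=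
  dg_le_add fun _ hu _ => Finset.mem_union.1 hu

theorem Clo.compl {U D : Finset V} (h : Clo G U D) : Clo G U (U \ D) := by
  intro d hd u hu a
  rw [Finset.mem_sdiff] at hd ⊢
  exact ⟨hu, fun hu' => hd.2 (h u hu' d hd.1 a.symm)⟩

theorem Clo.trans {U E D : Finset V} (hE : Clo G U E) (hD : Clo G E D) (hs : D ⊆ E) :
    Clo G U D := fun d hd u hu a => hD d hd u (hE d (hs hd) u hu a) a

theorem Clo.cloX {U D : Finset V} (h : Clo G U D) (b : V) : CloX G U D b :=
  fun d hd u hu a => .inl (h d hd u hu a)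

theorem CloX.clo {U D : Finset V} {b : V} (h : CloX G U D b) (hb : b ∉ U) : Clo G U D :=
  fun d hd u hu a => (h d hd u hu a).resolve_right (by rintro rfl; exact hb hu)

theorem Clo.self (U : Finset V) : Clo G U U := fun _ _ _ hu _ => hu

theorem exists_comp {U : Finset V} {v : V} (hv : v ∈ U) :
    ∃ E ⊆ U, v ∈ E ∧ Clo G U E ∧ Conn G E := by
  obtain ⟨E, ⟨h1, h2, h3⟩, hmin⟩ := exists_minimal_of_wellFoundedLT
    (fun E : Finset V => E ⊆ U ∧ v ∈ E ∧ Clo G U E) ⟨U, subset_rfl, hv, Clo.self U⟩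
  refine ⟨E, h1, h2, h3, fun D hD hne hc => ?_⟩
  by_cases hvD : v ∈ D
  · exact subset_antisymm hD (hmin ⟨hD.trans h1, hvD, h3.trans hc hD⟩ hD)
  · have := hmin (y := E \ D) ⟨Finset.sdiff_subset.trans h1, Finset.mem_sdiff.2 ⟨h2, hvD⟩,
      h3.trans hc.compl Finset.sdiff_subset⟩ Finset.sdiff_subset
    obtain ⟨d, hd⟩ := hne
    exact absurd hd (Finset.mem_sdiff.1 (this (hD hd))).2

theorem Conn.path {U : Finset V} (h : Conn G U) {u v : V} (hu : u ∈ U) (hv : v ∈ U) :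
    ∃ n, PIn G U u v n := by
  classical
  have := h (U.filter fun w => ∃ n, PIn G U u w n) (Finset.filter_subset _ _)
    ⟨u, Finset.mem_filter.2 ⟨hu, 0, .nil hu⟩⟩ (fun d hd w hw a => by
      rw [Finset.mem_filter] at hd ⊢
      obtain ⟨_, n, hn⟩ := hd
      exact ⟨hw, hn.extend a hw⟩)
  rw [← this, Finset.mem_filter] at hv
  exact hv.2

theorem link {C D : Finset V} {b : V} {S : Set V} (hC : Conn G C) (hD : D ⊆ C) (hb : b ∈ C)
    (hbD : b ∉ D) (hX : CloX G C D b) (hS : Meets C S) (hDS : ¬ Meets D S) :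
    ∃ a ∈ S, ∃ r, PIn G (C \ D) a b r := by
  classical
  set E := (C \ D).filter fun w => ∃ r, PIn G (C \ D) b w r with hE
  have hbE : b ∈ E := by
    have : b ∈ C \ D := Finset.mem_sdiff.2 ⟨hb, hbD⟩
    exact Finset.mem_filter.2 ⟨this, 0, .nil this⟩
  have key := hC (E ∪ D) (Finset.union_subset ((Finset.filter_subset _ _).trans
    Finset.sdiff_subset) hD) ⟨b, Finset.mem_union_left _ hbE⟩ (by
      intro d hd u hu a
      by_cases huD : u ∈ D
      · exact Finset.mem_union_right _ huD
      refine Finset.mem_union_left _ ?_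
      rcases Finset.mem_union.1 hd with hd | hd
      · obtain ⟨_, n, hn⟩ := Finset.mem_filter.1 hd
        have : u ∈ C \ D := Finset.mem_sdiff.2 ⟨hu, huD⟩
        exact Finset.mem_filter.2 ⟨this, hn.extend a this⟩
      · rcases hX d hd u hu a with h | rfl
        · exact absurd h huD
        · exact hbE)
  obtain ⟨a, ha, haS⟩ := hS
  rw [← key] at ha
  rcases Finset.mem_union.1 ha with h | h
  · obtain ⟨_, r, hr⟩ := Finset.mem_filter.1 h
    exact ⟨a, haS, r, hr.symm⟩
  · exact absurd ⟨a, h, haS⟩ hDS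

theorem Adm.mono {k l : ℕ} {X Y : Set ℕ} (h : Adm l X) (hk : k ≤ l) (hX : X ⊆ Y) : Adm k Y := by
  obtain ⟨c, d, hd, h⟩ := h
  exact ⟨c, d, hd, fun i hi => hX (h i (hi.trans_le hk))⟩

theorem Adm.shift {k : ℕ} {X Y : Set ℕ} (h : Adm k X) (e : ℕ) (hX : ∀ x ∈ X, x + e ∈ Y) :
    Adm k Y := by
  obtain ⟨c, d, hd, h⟩ := h
  refine ⟨c + e, d, hd, fun i hi => ?_⟩
  rw [show c + e + d * i = c + d * i + e by ring]
  exact hX _ (h i hi)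

theorem adm_of_lens {k m : ℕ} {X : Set ℕ} {c d : ℕ} (hd : d = 1 ∨ d = 2) (h : ∀ j < m, c + d * j ∈ X)
    (hk : k ≤ m) : Adm k X := ⟨c, d, hd, fun i hi => h i (hi.trans_le hk)⟩

theorem Adm.add {k l : ℕ} {X Y Z : Set ℕ} (hX : Adm k X) (hY : Adm l Y) (hk : 1 ≤ k) (hl : 1 ≤ l)
    (e : ℕ) (hZ : ∀ x ∈ X, ∀ y ∈ Y, x + y + e ∈ Z) : Adm (k + l - 1) Z := by
  obtain ⟨c, d, hd, hX⟩ := hX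
  obtain ⟨c', d', hd', hY⟩ := hY
  have key : ∃ f, (f = 1 ∨ f = 2) ∧ ∀ n < k + l - 1, ∃ i < k, ∃ j < l, f * n = d * i + d' * j := by
    by_cases h : d = d'
    · subst h
      refine ⟨d, hd, fun n hn => ?_⟩
      by_cases h : n < k
      · exact ⟨n, h, 0, by omega, by ring⟩
      · refine ⟨k - 1, by omega, n - (k - 1), by omega, ?_⟩
        rw [← Nat.mul_add]; congr 1; omega
    by_cases hk1 : k = 1
    · exact ⟨d', hd', fun n hn => ⟨0, by omega, n, by omega, by ring⟩⟩
    by_cases hl1 : l = 1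
    · exact ⟨d, hd, fun n hn => ⟨n, by omega, 0, by omega, by ring⟩⟩
    refine ⟨1, .inl rfl, fun n hn => ?_⟩
    rcases hd with rfl | rfl <;> rcases hd' with rfl | rfl
    · exact absurd rfl h
    · by_cases h2 : n / 2 ≤ l - 1
      · exact ⟨n % 2, by omega, n / 2, by omega, by omega⟩
      · exact ⟨n - 2 * (l - 1), by omega, l - 1, by omega, by omega⟩
    · by_cases h2 : n / 2 ≤ k - 1
      · exact ⟨n / 2, by omega, n % 2, by omega, by omega⟩
      · exact ⟨k - 1, by omega, n - 2 * (k - 1), by omega, by omega⟩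
    · exact absurd rfl h
  obtain ⟨f, hf, key⟩ := key
  refine ⟨c + c' + e, f, hf, fun n hn => ?_⟩
  obtain ⟨i, hi, j, hj, h⟩ := key n hn
  rw [h, show c + c' + e + (d * i + d' * j) = (c + d * i) + (c' + d' * j) + e by ring]
  exact hZ _ (hX i hi) _ (hY j hj)

theorem Adm.lens {k m : ℕ} {X Y : Set ℕ} (hX : Adm k X) (hk : 1 ≤ k) (hm : 1 ≤ m) {d : ℕ}
    (hd : d = 1 ∨ d = 2) (e : ℕ) (hY : ∀ x ∈ X, ∀ j < m, x + e + d * j ∈ Y) :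
    Adm (k + m - 1) Y := by
  refine hX.add (Y := {n | ∃ j < m, n = d * j}) ⟨0, d, hd, fun i hi => ⟨i, hi, by simp⟩⟩ hk hm e ?_
  rintro x hx _ ⟨j, hj, rfl⟩
  rw [show x + d * j + e = x + e + d * j by ring]
  exact hY x hx j hj

end Basics

section ExplicitPaths

variable {V : Type*} [DecidableEq V] {G : SimpleGraph V} [DecidableRel G.Adj]

/-- the vertices of `K` are pairwise adjacent -/
def Clq (G : SimpleGraph V) (K : Finset V) : Prop := ∀ u ∈ K, ∀ v ∈ K, u ≠ v → G.Adj u v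

theorem Clq.subset {K L : Finset V} (h : Clq G K) (hs : L ⊆ K) : Clq G L :=
  fun u hu v hv => h u (hs hu) v (hs hv)

theorem Clq.insert {K : Finset V} {x : V} (h : Clq G K) (hx : ∀ u ∈ K, G.Adj x u) :
    Clq G (insert x K) := by
  intro u hu v hv huv
  rcases Finset.mem_insert.1 hu with e | hu' <;> rcases Finset.mem_insert.1 hv with e' | hv'
  · exact absurd (e.trans e'.symm) huv
  · exact e ▸ hx v hv'
  · exact e' ▸ (hx u hu').symm
  · exact h u hu' v hv' huv

theorem Clq.path {K : Finset V} {κ : V} {j : ℕ} (hK : Clq G K) (hκ : κ ∈ K) (hj : j < K.card) :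
    ∃ b ∈ K, PIn G K κ b j := by
  induction j generalizing K κ with
  | zero => exact ⟨κ, hκ, .nil hκ⟩
  | succ j ih =>
    have hc : (K.erase κ).card = K.card - 1 := Finset.card_erase_of_mem hκ
    obtain ⟨w, hw⟩ := Finset.card_pos.1 (by omega : 0 < (K.erase κ).card)
    obtain ⟨b, hb, h⟩ := ih (hK.subset (Finset.erase_subset κ K)) hw (by omega)
    exact ⟨b, Finset.mem_of_mem_erase hb, .cons hκ
      (hK _ hκ _ (Finset.mem_of_mem_erase hw) (Finset.ne_of_mem_erase hw).symm) h⟩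

theorem clique_join_path {K Θ : Finset V} {κ : V} {j : ℕ} (hK : Clq G K) (hd : Disjoint K Θ)
    (ha : ∀ u ∈ K, ∀ t ∈ Θ, G.Adj u t) (hκ : κ ∈ K) (h2 : 2 ≤ K.card) (h0 : 1 ≤ Θ.card)
    (hΘ : Θ.card ≤ 2) (hj : j < K.card + Θ.card - 1) :
    ∃ b ∈ Θ, PIn G (K ∪ Θ) κ b (1 + 1 * j) := by
  by_cases hjK : j < K.card
  · obtain ⟨t, ht⟩ := Finset.card_pos.1 h0
    obtain ⟨b, hb, h⟩ := hK.path hκ hjK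
    refine ⟨t, ht, ?_⟩
    rw [show 1 + 1 * j = j + 0 + 1 by omega]
    exact h.join (ha b hb t ht) (.nil ht) hd Finset.subset_union_left Finset.subset_union_right
  · have : Θ.card = 2 := by omega
    obtain ⟨t, t', hne, rfl⟩ := Finset.card_eq_two.1 this
    have hc : (K.erase κ).card = K.card - 1 := Finset.card_erase_of_mem hκ
    obtain ⟨w, hw⟩ := Finset.card_pos.1 (by omega : 0 < (K.erase κ).card)
    obtain ⟨b, hb, h⟩ := (hK.subset (Finset.erase_subset κ K)).path (j := K.card - 2) hw (by omega)
    have ht : t ∉ K := fun h => Finset.disjoint_left.1 hd h (by simp)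
    have ht' : t' ∉ K := fun h => Finset.disjoint_left.1 hd h (by simp)
    refine ⟨t, by simp, ?_⟩
    have h1 : PIn G (insert t (K.erase κ)) w t (K.card - 2 + 0 + 1) :=
      h.join (ha b (Finset.mem_of_mem_erase hb) t (by simp)) (.nil (Finset.mem_singleton_self t))
        (Finset.disjoint_singleton_right.2 fun h => ht (Finset.mem_of_mem_erase h))
        (Finset.subset_insert _ _) (by simp)
    have hκt' : G.Adj κ t' := ha κ hκ t' (by simp)
    have h2 : PIn G (insert t' (insert t (K.erase κ))) t' t (K.card - 2 + 0 + 1 + 1) := by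
      refine .cons (by simp) (ha w (Finset.mem_of_mem_erase hw) t' (by simp)).symm (h1.mono ?_)
      intro x hx
      refine Finset.mem_erase.2 ⟨?_, Finset.mem_insert_of_mem hx⟩
      rintro rfl
      rcases Finset.mem_insert.1 hx with rfl | hx
      · exact hne rfl
      · exact ht' (Finset.mem_of_mem_erase hx)
    rw [show 1 + 1 * j = K.card - 2 + 0 + 1 + 1 + 1 by omega]
    refine .cons (Finset.mem_union_left _ hκ) hκt' (h2.mono ?_)
    intro x hx
    simp only [Finset.mem_insert, Finset.mem_erase, Finset.mem_union, Finset.mem_singleton] at hx ⊢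
    rcases hx with rfl | rfl | hx
    · exact ⟨hκt'.ne', by simp⟩
    · exact ⟨(ha κ hκ x (by simp)).ne', by simp⟩
    · exact ⟨hx.1, .inl hx.2⟩

theorem bip_path {j : ℕ} : ∀ {P T : Finset V}, Disjoint P T → (∀ p ∈ P, ∀ t ∈ T, G.Adj p t) →
    (∀ κ ∈ T, j + 1 ≤ T.card → j ≤ P.card → ∃ b ∈ T, PIn G (P ∪ T) κ b (2 * j)) ∧
    (∀ p ∈ P, j + 1 ≤ T.card → j + 1 ≤ P.card → ∃ b ∈ T, PIn G (P ∪ T) p b (2 * j + 1)) := by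
  induction j with
  | zero =>
    intro P T hd ha
    refine ⟨fun κ hκ _ _ => ⟨κ, hκ, .nil (Finset.mem_union_right _ hκ)⟩, fun p hp hT _ => ?_⟩
    obtain ⟨t, ht⟩ := Finset.card_pos.1 hT
    exact ⟨t, ht, .cons (Finset.mem_union_left _ hp) (ha p hp t ht)
      (.nil (Finset.mem_erase.2 ⟨(ha p hp t ht).ne', Finset.mem_union_right _ ht⟩))⟩
  | succ j ih =>
    have step : ∀ {P T : Finset V}, Disjoint P T → (∀ p ∈ P, ∀ t ∈ T, G.Adj p t) →
        ∀ κ ∈ T, j + 2 ≤ T.card → j + 1 ≤ P.card → ∃ b ∈ T, PIn G (P ∪ T) κ b (2 * (j + 1)) := by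
      intro P T hd ha κ hκ hT hP
      obtain ⟨p, hp⟩ := Finset.card_pos.1 (by omega : 0 < P.card)
      have hc : (T.erase κ).card = T.card - 1 := Finset.card_erase_of_mem hκ
      obtain ⟨b, hb, h⟩ := (ih (hd.mono_right (Finset.erase_subset κ T))
        fun p hp t ht => ha p hp t (Finset.mem_of_mem_erase ht)).2 p hp (by omega) (by omega)
      refine ⟨b, Finset.mem_of_mem_erase hb, ?_⟩
      refine .cons (Finset.mem_union_right _ hκ) (ha p hp κ hκ).symm (h.mono fun x hx => ?_)
      rcases Finset.mem_union.1 hx with hx | hx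
      · exact Finset.mem_erase.2 ⟨fun e => Finset.disjoint_left.1 hd hx (e ▸ hκ),
          Finset.mem_union_left _ hx⟩
      · exact Finset.mem_erase.2 ⟨Finset.ne_of_mem_erase hx,
          Finset.mem_union_right _ (Finset.mem_of_mem_erase hx)⟩
    intro P T hd ha
    refine ⟨step hd ha, fun p hp hT hP => ?_⟩
    obtain ⟨t, ht⟩ := Finset.card_pos.1 (by omega : 0 < T.card)
    have hc : (P.erase p).card = P.card - 1 := Finset.card_erase_of_mem hp
    obtain ⟨b, hb, h⟩ := step (hd.mono_left (Finset.erase_subset p P))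
      (fun p hp t ht => ha p (Finset.mem_of_mem_erase hp) t ht) t ht (by omega) (by omega)
    refine ⟨b, hb, ?_⟩
    refine .cons (Finset.mem_union_left _ hp) (ha p hp t ht) (h.mono fun x hx => ?_)
    rcases Finset.mem_union.1 hx with hx | hx
    · exact Finset.mem_erase.2 ⟨Finset.ne_of_mem_erase hx,
          Finset.mem_union_left _ (Finset.mem_of_mem_erase hx)⟩
    · exact Finset.mem_erase.2 ⟨fun e => Finset.disjoint_left.1 hd hp (e ▸ hx),
        Finset.mem_union_right _ hx⟩

end ExplicitPaths

section Core

variable {V : Type*} [DecidableEq V] (G : SimpleGraph V) [DecidableRel G.Adj]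

/-- The assertion that every admissible labelled instance on `U` has `k` admissible path lengths.
The vertices of the clique `Δ` are exempt from the degree condition. -/
def FConc (U : Finset V) : Prop :=
  ∀ (Δ : Finset V) (A : Set V) (α : V → ℕ) (B : Set V) (k : ℕ), Good G U A B →
    (U \ Δ).Nonempty → Δ ⊆ U → Clq G Δ → (∀ v ∈ Δ, v ∈ B) → (Δ.card = 1 → ∀ a b, α a = α b) →
    (2 ≤ k → ∀ v ∈ U \ Δ, k + 1 ≤ dg G U v + ind A v + ind B v) → Adm k (Val G U A α B)

/-- every `D` separated by a single vertex `b` meets both terminal sets -/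
def StrongFor (U : Finset V) (A B : Set V) (D : Finset V) (b : V) : Prop :=
  D.Nonempty → b ∉ D → CloX G U D b → Meets D A ∧ Meets D B

variable {G}

theorem FConc.ext {C : Finset V} {A B : Set V} {α : V → ℕ} {k m d e : ℕ} {X : Set ℕ}
    (h : FConc G C) (hne : C.Nonempty) (hg : Good G C A B) (hm : 1 ≤ m) (hd : d = 1 ∨ d = 2)
    (hdeg : ∀ v ∈ C, k + 2 ≤ dg G C v + ind A v + ind B v + m)
    (hX : ∀ n ∈ Val G C A α B, ∀ j < m, n + e + d * j ∈ X) : Adm k X := by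
  have := h ∅ A α B (max 1 (k + 1 - m)) hg (by simpa using hne) (by simp) (by simp [Clq])
    (by simp) (by simp) (fun hk v hv => by
      have := hdeg v (by simpa using hv)
      omega)
  exact (this.lens (by omega) hm hd e hX).mono (by omega) subset_rfl

theorem main_lens {U W C Y : Finset V} {A B : Set V} {α : V → ℕ} {k m c d : ℕ}
    (IH : FConc G C) (hne : C.Nonempty) (hCU : C ⊆ U) (hW : W ⊆ U) (hCW : Disjoint C W)
    (hg : Good G C A (nbs G Y)) (hm : 1 ≤ m) (hd : d = 1 ∨ d = 2)
    (hlens : ∀ κ ∈ Y, ∀ j < m, ∃ b ∈ B, PIn G W b κ (c + d * j))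
    (hN : ∀ v ∈ C, ∀ u ∈ U, G.Adj v u → u ∈ C ∨ u ∈ W)
    (hcount : ∀ v ∈ C, dg G W v + ind B v + 1 ≤ m + ind (nbs G Y) v)
    (hdeg : ∀ v ∈ C, k + 1 ≤ dg G U v + ind A v + ind B v) : Adm k (Val G U A α B) := by
  refine IH.ext (α := α) (e := c + 1) hne hg hm hd (fun v hv => ?_) ?_
  · have h1 := dg_le_add (hN v hv)
    have h2 := hcount v hv
    have h3 := hdeg v hv
    omega
  · rintro n ⟨a, ha, v, ⟨κ, hκ, hvκ⟩, l, hl, rfl⟩ j hj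
    obtain ⟨b, hb, hp⟩ := hlens κ hκ j hj
    exact ⟨a, ha, b, hb, _, hl.join hvκ hp.symm hCW hCU hW, by ring⟩

/-- entry points of a part `D` from a lens attached to `Y` -/
def entry (G : SimpleGraph V) (Y : Finset V) (B : Set V) (m : ℕ) : Set V :=
  {v | v ∈ nbs G Y ∨ (m = 1 ∧ v ∈ B)}

theorem end_lens {U D E W' WL Y : Finset V} {A B : Set V} {α lam : V → ℕ} {k m d r : ℕ} {a₀ b : V}
    (IH : FConc G D) (hne : D.Nonempty) (hDU : D ⊆ U) (hWU : WL ⊆ U) (hEU : E ⊆ U)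
    (hDW : Disjoint D WL) (hDE : Disjoint D E) (hWE : Disjoint WL E)
    (hDA : ∀ v ∈ D, v ∉ A)
    (hN : ∀ v ∈ D, ∀ u ∈ U, G.Adj v u → u ∈ D ∨ u = b ∨ u ∈ W')
    (hg : Good G D (entry G Y B m) (nbs G {b})) (hm : 1 ≤ m) (hd : d = 1 ∨ d = 2)
    (hcount : ∀ v ∈ D, dg G W' v + ind B v + 1 ≤ m + ind (entry G Y B m) v)
    (hlens : ∀ z ∈ Y, ∀ j < m, ∃ b₀ ∈ B, PIn G WL b₀ z (lam z + d * j))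
    (ha₀ : a₀ ∈ A) (hexit : PIn G E a₀ b r)
    (hdeg : ∀ v ∈ D, k + 1 ≤ dg G U v + ind A v + ind B v) : Adm k (Val G U A α B) := by
  classical
  have hex : ∀ v, ∃ n, v ∈ nbs G Y → ∃ z ∈ Y, G.Adj v z ∧ n = lam z + 1 := fun v => by
    by_cases h : v ∈ nbs G Y
    · obtain ⟨z, hz, ha⟩ := h
      exact ⟨_, fun _ => ⟨z, hz, ha, rfl⟩⟩
    · exact ⟨0, fun h' => absurd h' h⟩
  choose μ hμ using hex
  refine IH.ext (α := fun v => if v ∈ nbs G Y then μ v else 0) (e := α a₀ + r + 1) hne hg hm hd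
    (fun v hv => ?_) ?_
  · have h1 : dg G U v ≤ dg G D v + dg G ({b} ∪ W') v :=
      dg_le_add fun u hu ha => by simpa using hN v hv u hu ha
    have h2 := hcount v hv
    have h3 := hdeg v hv
    have h4 := dg_union (G := G) (U := {b}) (W := W') v
    have h5 := dg_singleton_le (G := G) b v
    have h6 : ind A v = 0 := ind_of_notMem (hDA v hv)
    omega
  · rintro n ⟨v, hv, w, hw, l, hl, rfl⟩ j hj
    rw [mem_nbs_singleton] at hw
    by_cases hvY : v ∈ nbs G Y
    · obtain ⟨z, hz, hvz, he⟩ := hμ v hvY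
      obtain ⟨b₀, hb₀, hp⟩ := hlens z hz j hj
      have h1 := hp.join hvz.symm hl hDW.symm (U := D ∪ WL) Finset.subset_union_right
        Finset.subset_union_left
      have h2 := hexit.join hw.symm h1.symm (U := U)
        (Finset.disjoint_union_right.2 ⟨hDE.symm, hWE.symm⟩) hEU (Finset.union_subset hDU hWU)
      refine ⟨a₀, ha₀, b₀, hb₀, _, h2, ?_⟩
      simp only [if_pos hvY, he]
      ring
    · rcases hv with hv | ⟨rfl, hvB⟩
      · exact absurd hv hvY
      obtain rfl : j = 0 := by omega
      have h2 := hexit.join hw.symm hl.symm (U := U) hDE.symm hEU hDU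
      refine ⟨a₀, ha₀, v, hvB, _, h2, ?_⟩
      simp only [if_neg hvY]
      ring

theorem adm_or_obstruction {U W T : Finset V} {A B : Set V} {α : V → ℕ} {k m m' c c' d d' : ℕ}
    (IH : ∀ C : Finset V, C.card < U.card → FConc G C) (hU : Conn G U)
    (hS : ∀ b, ∀ D ⊆ U, (D ⊆ U \ W ∨ b ∈ W \ T) → StrongFor G U A B D b)
    (hW : W ⊆ U) (hT : T ⊆ W) (hTne : T.Nonempty) (hm : 1 ≤ m) (hm' : 1 ≤ m')
    (hd : d = 1 ∨ d = 2) (hd' : d' = 1 ∨ d' = 2)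
    (hlens : ∀ κ ∈ T, ∀ j < m, ∃ b ∈ B, PIn G W b κ (c + d * j))
    (hlens' : ∀ κ ∈ W \ T, ∀ j < m', ∃ b ∈ B, PIn G W b κ (c' + d' * j))
    (hc1 : ∀ v ∈ U \ W, v ∈ nbs G T → dg G W v + ind B v ≤ m)
    (hc2 : ∀ v ∈ U \ W, v ∉ nbs G T → dg G W v + ind B v ≤ m' ∧ dg G W v + ind B v + 1 ≤ m)
    (hZ : m' = 1 → (W \ T).card ≤ 1)
    (hdeg : ∀ v ∈ U \ W, k + 1 ≤ dg G U v + ind A v + ind B v) :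
    Adm k (Val G U A α B) ∨
      ((∀ C ⊆ U \ W, Conn G C → Clo G (U \ W) C → Meets C A → ¬ Meets C (nbs G T)) ∧
        ((∃ a ∈ T, a ∈ A) ∨ ∀ a ∈ A, a ∈ U → a ∈ W) ∧
        (W = T → ∀ a ∈ A, a ∈ U → a ∈ W) ∧ (2 ≤ m' → ∀ a ∈ A, a ∈ U → a ∈ W)) := by
  by_cases hgoal : Adm k (Val G U A α B)
  · exact .inl hgoal
  right
  have hsub : ∀ C ⊆ U \ W, C ⊆ U := fun C h => h.trans Finset.sdiff_subset
  have hcard : ∀ C ⊆ U \ W, C.card < U.card := fun C h => by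
    obtain ⟨κ, hκ⟩ := hTne
    refine Finset.card_lt_card ⟨hsub C h, fun h' => ?_⟩
    exact (Finset.mem_sdiff.1 (h (h' (hW (hT hκ))))).2 (hT hκ)
  have hdisj : ∀ C ⊆ U \ W, Disjoint C W := fun C h =>
    Finset.disjoint_left.2 fun v hv => (Finset.mem_sdiff.1 (h hv)).2
  have hNC : ∀ C ⊆ U \ W, Clo G (U \ W) C → ∀ v ∈ C, ∀ u ∈ U, G.Adj v u → u ∈ C ∨ u ∈ W := by
    intro C _ hcl v hv u hu ha
    by_cases h : u ∈ W
    · exact .inr h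
    · exact .inl (hcl v hv u (Finset.mem_sdiff.2 ⟨hu, h⟩) ha)
  have hmeet : ∀ C ⊆ U \ W, Conn G C → Clo G (U \ W) C → Meets C A → ¬ Meets C (nbs G T) := by
    intro C hC hcon hclo hCA hCT
    have hCne : C.Nonempty := hCA.imp fun _ h => h.1
    by_cases hv : ∃ b, ∃ D ⊆ C, D.Nonempty ∧ b ∉ D ∧ CloX G C D b ∧ ¬ Meets D A ∧
        ¬ Meets D (nbs G T)
    · obtain ⟨b, D, hD, hDne, hbD, hX, hDA, hDT⟩ := hv
      have hbC : b ∈ C := by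
        by_contra hb
        exact hDA (hcon D hD hDne (hX.clo hb) ▸ hCA)
      obtain ⟨a₀, ha₀, r, hr⟩ := link hcon hD hbC hbD hX hCA hDA
      have hDU := hD.trans hC
      have hDTn : ∀ v ∈ D, ∀ u ∈ T, ¬ G.Adj v u := fun v hv u hu ha => hDT ⟨v, hv, u, hu, ha⟩
      have hN : ∀ v ∈ D, ∀ u ∈ U, G.Adj v u → u ∈ D ∨ u = b ∨ u ∈ W \ T := by
        intro v hv u hu ha
        rcases hNC C hC hclo v (hD hv) u hu ha with h | h
        · rcases hX v hv u h ha with h | h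
          · exact .inl h
          · exact .inr (.inl h)
        · exact .inr (.inr (Finset.mem_sdiff.2 ⟨h, fun h' => hDTn v hv u h' ha⟩))
      refine hgoal (end_lens (W' := W \ T) (Y := W \ T) (WL := W) (E := C \ D) (m := m')
        (lam := fun _ => c') (IH D (hcard D hDU)) hDne (hsub D hDU) hW
        (Finset.sdiff_subset.trans (hsub C hC)) (hdisj D hDU) Finset.disjoint_sdiff
        ((hdisj C hC).symm.mono_right Finset.sdiff_subset) (fun v hv h => hDA ⟨v, hv, h⟩) hN ?_
        hm' hd' ?_ hlens' ha₀ hr (fun v hv => hdeg v (hDU hv)))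
      · constructor
        · intro D1 hD1 hne1 hcl1
          constructor
          · by_contra hE
            have := (hS b D1 (hD1.trans (hsub D hDU)) (.inl (hD1.trans hDU)) hne1
              (fun h => hbD (hD1 h)) (fun v hv u hu ha => by
                rcases hN v (hD1 hv) u hu ha with h | h | h
                · exact .inl (hcl1 v hv u h ha)
                · exact .inr h
                · exact absurd ⟨v, hv, .inl ⟨u, h, ha⟩⟩ hE)).1
            exact hDA (this.imp fun x hx => ⟨hD1 hx.1, hx.2⟩)
          · by_contra hE
            have : D1 = C := hcon D1 (hD1.trans hD) hne1 (fun v hv u hu ha => by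
              rcases hX v (hD1 hv) u hu ha with h | rfl
              · exact hcl1 v hv u h ha
              · exact absurd ⟨v, hv, mem_nbs_singleton.2 ha⟩ hE)
            exact hbD (hD1 (this ▸ hbC))
        · intro b1 D1 hD1 hne1 hb1 hX1
          by_contra! hE
          have := (hS b1 D1 (hD1.trans (hsub D hDU)) (.inl (hD1.trans hDU)) hne1 hb1
            (fun v hv u hu ha => by
              rcases hN v (hD1 hv) u hu ha with h | rfl | h
              · exact hX1 v hv u h ha
              · exact absurd ⟨v, hv, mem_nbs_singleton.2 ha⟩ hE.2
              · exact absurd ⟨v, hv, .inl ⟨u, h, ha⟩⟩ hE.1)).1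
          exact hDA (this.imp fun x hx => ⟨hD1 hx.1, hx.2⟩)
      · intro v hv
        have h1 := hc2 v (hDU hv) (fun h => hDT ⟨v, hv, h⟩)
        have h2 := dg_mono (G := G) (Finset.sdiff_subset : W \ T ⊆ W) v
        by_cases he : v ∈ entry G (W \ T) B m'
        · rw [ind_of_mem he]; omega
        · have h3 : dg G (W \ T) v = 0 := dg_eq_zero fun u hu ha => he (.inl ⟨u, hu, ha⟩)
          have h4 : m' = 1 → ind B v = 0 := fun h => ind_of_notMem fun h' => he (.inr ⟨h, h'⟩)
          have h5 := ind_le_one B v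
          by_cases h6 : m' = 1
          · have := h4 h6; omega
          · omega
    · push Not at hv
      refine hgoal (main_lens (IH C (hcard C hC)) hCne (hsub C hC) hW (hdisj C hC)
        (Y := T) ?_ hm hd hlens (hNC C hC hclo) ?_ (fun v hv => hdeg v (hC hv)))
      · constructor
        · intro D hD hDne hDc
          rw [hcon D hD hDne hDc]
          exact ⟨hCA, hCT⟩
        · intro b D hD hDne hb hX
          by_contra! h
          exact h.2 (hv b D hD hDne hb hX h.1)
      · intro v hv
        by_cases h : v ∈ nbs G T
        · rw [ind_of_mem h]; have := hc1 v (hC hv) h; omega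
        · have := (hc2 v (hC hv) h).2; omega
  have hnoclo : ∀ C ⊆ U \ W, C.Nonempty → ¬ Clo G U C := by
    intro C hC hne hcl
    have := hU C (hsub C hC) hne hcl
    exact (hcard C hC).ne (by rw [this])
  have hcomp : ∀ a ∈ A, a ∈ U → a ∉ W → ∃ C ⊆ U \ W, a ∈ C ∧ Clo G (U \ W) C ∧ Conn G C ∧
      ¬ Meets C (nbs G T) := by
    intro a ha haU haW
    obtain ⟨C, hC, haC, hcl, hcon⟩ := exists_comp (G := G) (Finset.mem_sdiff.2 ⟨haU, haW⟩)
    exact ⟨C, hC, haC, hcl, hcon, hmeet C hC hcon hcl ⟨a, haC, ha⟩⟩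
  have hZmeet : ∀ C ⊆ U \ W, C.Nonempty → Clo G (U \ W) C → ¬ Meets C (nbs G T) →
      Meets C (nbs G (W \ T)) := by
    intro C hC hne hcl hnT
    by_contra h
    refine hnoclo C hC hne fun v hv u hu ha => ?_
    rcases hNC C hC hcl v hv u hu ha with h1 | h1
    · exact h1
    · by_cases h2 : u ∈ T
      · exact absurd ⟨v, hv, u, h2, ha⟩ hnT
      · exact absurd ⟨v, hv, u, Finset.mem_sdiff.2 ⟨h1, h2⟩, ha⟩ h
  have last : 2 ≤ m' → ∀ a ∈ A, a ∈ U → a ∈ W := by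
    intro h2 a ha haU
    by_contra haW
    obtain ⟨C, hC, haC, hcl, hcon, hnT⟩ := hcomp a ha haU haW
    have hZm := hZmeet C hC ⟨a, haC⟩ hcl hnT
    refine hgoal (main_lens (IH C (hcard C hC)) ⟨a, haC⟩ (hsub C hC) hW (hdisj C hC)
      (Y := W \ T) ?_ hm' hd' hlens' (hNC C hC hcl) ?_ (fun v hv => hdeg v (hC hv)))
    · constructor
      · intro D hD hDne hDc
        rw [hcon D hD hDne hDc]
        exact ⟨⟨a, haC, ha⟩, hZm⟩
      · intro b D hD hDne hb hX
        by_contra! h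
        refine h.1 (hS b D (hD.trans (hsub C hC)) (.inl (hD.trans hC)) hDne hb
          fun v hv u hu ha => ?_).1
        rcases hNC C hC hcl v (hD hv) u hu ha with h1 | h1
        · exact hX v hv u h1 ha
        · by_cases h2 : u ∈ T
          · exact absurd ⟨v, hD hv, u, h2, ha⟩ hnT
          · exact absurd ⟨v, hv, u, Finset.mem_sdiff.2 ⟨h1, h2⟩, ha⟩ h.2
    · intro v hv
      have h1 := (hc2 v (hC hv) fun h => hnT ⟨v, hv, h⟩)
      by_cases h : v ∈ nbs G (W \ T)
      · rw [ind_of_mem h]; omega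
      · have h3 : dg G W v = 0 := dg_eq_zero fun u hu ha => by
          by_cases h2 : u ∈ T
          · exact hnT ⟨v, hv, u, h2, ha⟩
          · exact h ⟨u, Finset.mem_sdiff.2 ⟨hu, h2⟩, ha⟩
        have := ind_le_one B v
        omega
  refine ⟨hmeet, ?_, ?_, last⟩
  · by_contra! hcon
    obtain ⟨hTA, a, ha, haU, haW⟩ := hcon
    obtain ⟨C, hC, haC, hcl, -, hnT⟩ := hcomp a ha haU haW
    obtain ⟨v, hv, z, hz, hvz⟩ := hZmeet C hC ⟨a, haC⟩ hcl hnT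
    by_cases h2 : 2 ≤ m'
    · exact haW (last h2 a ha haU)
    have hZc := hZ (by omega)
    have hZeq : ∀ w ∈ W, w ≠ z → w ∈ T := by
      intro w hw hwz
      by_contra h
      exact hwz (Finset.card_le_one.1 hZc w (Finset.mem_sdiff.2 ⟨hw, h⟩) z hz)
    obtain ⟨κ, hκ⟩ := hTne
    have hzW := (Finset.mem_sdiff.1 hz)
    have hκz : κ ≠ z := by rintro rfl; exact hzW.2 hκ
    obtain ⟨R, hR, hκR, hRcl, hRcon⟩ := exists_comp (G := G)
      (Finset.mem_erase.2 ⟨hκz, hW (hT hκ)⟩ : κ ∈ U.erase z)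
    obtain ⟨a', ha'R, ha'⟩ := (hS z R (hR.trans (Finset.erase_subset _ _)) (.inr hz) ⟨κ, hκR⟩
      (fun h => Finset.notMem_erase z U (hR h)) (fun v hv u hu ha => by
        by_cases h : u = z
        · exact .inr h
        · exact .inl (hRcl v hv u (Finset.mem_erase.2 ⟨h, hu⟩) ha))).1
    have ha'U := Finset.mem_erase.1 (hR ha'R)
    have ha'W : a' ∉ W := fun h => hTA a' (hZeq a' h ha'U.1) ha'
    obtain ⟨C', hC', haC', hcl', -, hnT'⟩ := hcomp a' ha' ha'U.2 ha'W
    have := hRcon (R ∩ C') Finset.inter_subset_left ⟨a', Finset.mem_inter.2 ⟨ha'R, haC'⟩⟩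
      (fun v hv u hu ha => by
        rw [Finset.mem_inter] at hv ⊢
        refine ⟨hu, ?_⟩
        have hu' := Finset.mem_erase.1 (hR hu)
        rcases hNC C' hC' hcl' v hv.2 u hu'.2 ha with h | h
        · exact h
        · exact absurd ⟨v, hv.2, u, hZeq u h hu'.1, ha⟩ hnT')
    rw [← this] at hκR
    exact (Finset.mem_sdiff.1 (hC' (Finset.mem_inter.1 hκR).2)).2 (hT hκ)
  · rintro rfl a ha haU
    by_contra haW
    obtain ⟨C, hC, haC, hcl, -, hnT⟩ := hcomp a ha haU haW
    obtain ⟨v, hv, z, hz, hvz⟩ := hZmeet C hC ⟨a, haC⟩ hcl hnT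
    simp at hz

end Core

section Reductions

variable {V : Type*} [DecidableEq V] (G : SimpleGraph V) [DecidableRel G.Adj]

/-- A connected instance in which separated parts avoiding `Δ` meet both terminal sets, and such
that all smaller instances are settled. -/
structure Inst (U Δ : Finset V) (A B : Set V) (k : ℕ) : Prop where
  IH : ∀ C : Finset V, C.card < U.card → FConc G C
  conn : Conn G U
  ne : (U \ Δ).Nonempty
  clq : Clq G Δ
  sub : Δ ⊆ U
  subB : ∀ v ∈ Δ, v ∈ B
  good : Good G U A B
  strong : ∀ b, ∀ D ⊆ U, Disjoint D Δ → StrongFor G U A B D b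
  two : 2 ≤ k
  deg : ∀ v ∈ U \ Δ, k + 1 ≤ dg G U v + ind A v + ind B v

variable {G} {U Δ : Finset V} {A B : Set V} {α : V → ℕ} {k : ℕ}

theorem Inst.meets (h : Inst G U Δ A B k) : Meets U A ∧ Meets U B :=
  h.good.c1 U subset_rfl (h.ne.mono Finset.sdiff_subset) (Clo.self U)

theorem Inst.strong' (h : Inst G U ∅ A B k) (b : V) (D : Finset V) (hD : D ⊆ U)
    (hne : D.Nonempty) (hb : b ∉ D) (hX : CloX G U D b) : Meets D A ∧ Meets D B :=
  h.strong b D hD (Finset.disjoint_empty_right D) hne hb hX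

theorem Inst.deg' (h : Inst G U ∅ A B k) {v : V} (hv : v ∈ U) :
    k + 1 ≤ dg G U v + ind A v + ind B v := h.deg v (by simpa using hv)

theorem cloX_of_erase {U D : Finset V} {a : V} (h : Clo G (U.erase a) D) : CloX G U D a := by
  intro v hv u hu hvu
  by_cases e : u = a
  · exact .inr e
  · exact .inl (h v hv u (Finset.mem_erase.2 ⟨e, hu⟩) hvu)

theorem CloX.of_erase {U D : Finset V} {a b : V} (h : CloX G (U.erase a) D b)
    (hn : ¬ Meets D (nbs G {a})) : CloX G U D b := by
  intro v hv u hu hvu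
  refine h v hv u (Finset.mem_erase.2 ⟨?_, hu⟩) hvu
  rintro rfl
  exact hn ⟨v, hv, mem_nbs_singleton.2 hvu⟩

theorem Clo.of_erase {U D : Finset V} {a : V} (h : Clo G (U.erase a) D)
    (hn : ¬ Meets D (nbs G {a})) : Clo G U D := by
  intro v hv u hu hvu
  refine h v hv u (Finset.mem_erase.2 ⟨?_, hu⟩) hvu
  rintro rfl
  exact hn ⟨v, hv, mem_nbs_singleton.2 hvu⟩

theorem Inst.peel (h : Inst G U ∅ A B k) {a : V} (haU : a ∈ U) (haA : a ∈ A)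
    (hind : ∀ v ∈ U, v ∈ A → ¬ G.Adj v a) : Adm k (Val G U A α B) := by
  classical
  have hind1 : ∀ v, ind A v ≤ 1 := ind_le_one A
  have hind2 : ∀ v, ind B v ≤ 1 := ind_le_one B
  have hsub := Finset.erase_subset a U
  have key := h.IH (U.erase a) (Finset.card_erase_lt_of_mem haU) ∅ {v | G.Adj v a ∨ v ∈ A}
    (fun v => if G.Adj v a then α a + 1 else α v) B k ?_ ?_ (by simp) (by simp [Clq]) (by simp)
    (by simp) ?_
  · refine key.mono le_rfl ?_
    rintro n ⟨v, hv, b, hb, l, hl, rfl⟩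
    by_cases hva : G.Adj v a
    · exact ⟨a, haA, b, hb, l + 1, .cons haU hva.symm hl, by simp [hva]; ring⟩
    · exact ⟨v, hv.resolve_left hva, b, hb, l, hl.mono hsub, by simp [hva]⟩
  · constructor
    · intro D hD hne hcl
      have := h.strong' a D (hD.trans hsub) hne (fun h' => Finset.notMem_erase a U (hD h'))
        (cloX_of_erase hcl)
      exact ⟨this.1.imp fun x hx => ⟨hx.1, .inr hx.2⟩, this.2⟩
    · intro b D hD hne hb hX
      by_contra! hcon
      refine hcon.2 (h.strong' b D (hD.trans hsub) hne hb (hX.of_erase ?_)).2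
      rintro ⟨v, hv, hva⟩
      exact hcon.1 ⟨v, hv, .inl (mem_nbs_singleton.1 hva)⟩
  · have h1 := h.deg' haU
    have h2 := h.two
    have h3 := hind1 a
    have h4 := hind2 a
    rw [← dg_erase_self] at h1
    have h5 := dg_le_card (G := G) (U.erase a) a
    rw [Finset.sdiff_empty, ← Finset.card_pos]
    omega
  · intro _ v hv
    rw [Finset.sdiff_empty] at hv
    have hvU := hsub hv
    have h1 := h.deg' hvU
    have h2 := dg_erase_le (G := G) U a v
    by_cases hva : G.Adj v a
    · have h3 : ind A v = 0 := ind_of_notMem fun h' => hind v hvU h' hva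
      have h4 : ind {v | G.Adj v a ∨ v ∈ A} v = 1 := ind_of_mem (.inl hva)
      have := ind_le_one (nbs G {a}) v
      omega
    · have h3 : ind (nbs G {a}) v = 0 := ind_of_notMem fun h' => hva (mem_nbs_singleton.1 h')
      have h4 : ind A v ≤ ind {v | G.Adj v a ∨ v ∈ A} v := by
        by_cases h' : v ∈ A
        · rw [ind_of_mem (show v ∈ {v | G.Adj v a ∨ v ∈ A} from .inr h')]; exact hind1 v
        · rw [ind_of_notMem h']; exact Nat.zero_le _
      omega

theorem Inst.clique_peel (h : Inst G U Δ A B k) {K : Finset V} {a : V} (hK : Clq G K)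
    (hKU : K ⊆ U) (hΔK : Δ ⊆ K) (haK : a ∈ K) (haA : a ∈ A) (hAK : ∀ v ∈ A, v ∈ U → v ∈ K)
    (hne : (U \ K).Nonempty) : Adm k (Val G U A α B) := by
  have haU := hKU haK
  have hsub := Finset.erase_subset a U
  have key := h.IH (U.erase a) (Finset.card_erase_lt_of_mem haU) (K.erase a) B
    (fun _ => 0) (nbs G {a}) k ?_ ?_ (Finset.erase_subset_erase a hKU)
    (hK.subset (Finset.erase_subset _ _)) ?_ (by simp) ?_
  · refine key.shift (α a + 1) ?_
    rintro n ⟨b, hb, w, hw, l, hl, rfl⟩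
    exact ⟨a, haA, b, hb, l + 1, .cons haU (mem_nbs_singleton.1 hw).symm hl.symm, by ring⟩
  · constructor
    · intro D hD hneD hcl
      have haD : a ∉ D := fun h' => Finset.notMem_erase a U (hD h')
      constructor
      · by_cases hd : Disjoint D Δ
        · exact (h.strong a D (hD.trans hsub) hd hneD haD (cloX_of_erase hcl)).2
        · rw [Finset.not_disjoint_iff] at hd
          exact hd.imp fun x hx => ⟨hx.1, h.subB x hx.2⟩
      · by_contra hn
        have := h.conn D (hD.trans hsub) hneD (hcl.of_erase hn)
        exact haD (this ▸ haU)
    · intro b D hD hneD hb hX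
      by_contra! hcon
      refine hcon.1 (h.strong b D (hD.trans hsub) ?_ hneD hb (hX.of_erase hcon.2)).2
      exact Finset.disjoint_left.2 fun x hx hx' => hcon.1 ⟨x, hx, h.subB x hx'⟩
  · refine hne.mono fun v hv => ?_
    simp only [Finset.mem_sdiff, Finset.mem_erase] at hv ⊢
    exact ⟨⟨fun e => hv.2 (e ▸ haK), hv.1⟩, fun h' => hv.2 h'.2⟩
  · intro v hv
    rw [Finset.mem_erase] at hv
    exact mem_nbs_singleton.2 (hK v hv.2 a haK hv.1)
  · intro _ v hv
    simp only [Finset.mem_sdiff, Finset.mem_erase] at hv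
    have hvK : v ∉ K := fun h' => hv.2 ⟨hv.1.1, h'⟩
    have h1 := h.deg v (Finset.mem_sdiff.2 ⟨hv.1.2, fun h' => hvK (hΔK h')⟩)
    have h2 := dg_erase_le (G := G) U a v
    have h3 : ind A v = 0 := ind_of_notMem fun h' => hvK (hAK v h' hv.1.2)
    omega

theorem Inst.clique_case (h : Inst G U Δ A B k) {K : Finset V} (hK : Clq G K)
    (hKU : K ⊆ U) (hKB : ∀ v ∈ K, v ∈ B) (hΔK : Δ ⊆ K) (h2 : 2 ≤ K.card)
    (hmax : ∀ v ∈ U, v ∈ B → (∀ u ∈ K, G.Adj v u) → v ∈ K) : Adm k (Val G U A α B) := by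
  have hUK : ∀ v ∈ U \ K, v ∈ U \ Δ := fun v hv => Finset.sdiff_subset_sdiff subset_rfl hΔK hv
  refine (adm_or_obstruction (α := α) (m := K.card) (m' := 1) (W := K) (T := K) (c := 0) (c' := 0) (d := 1)
    (d' := 1) h.IH h.conn (fun b D hD h' => h.strong b D hD ?_) hKU subset_rfl
    (Finset.card_pos.1 (by omega)) (by omega) le_rfl (.inl rfl) (.inl rfl) ?_ (by simp) ?_ ?_
    (by simp) (fun v hv => h.deg v (hUK v hv))).elim id fun h1 => ?_
  · rcases h' with h' | h'
    · exact Finset.disjoint_left.2 fun x hx hx' => (Finset.mem_sdiff.1 (h' hx)).2 (hΔK hx')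
    · simp at h'
  · intro κ hκ j hj
    obtain ⟨b, hb, hp⟩ := hK.path hκ hj
    exact ⟨b, hKB b hb, by simpa using hp.symm⟩
  · intro v hv _
    rw [Finset.mem_sdiff] at hv
    by_cases hvB : v ∈ B
    · have : ∃ u ∈ K, ¬ G.Adj v u := by
        by_contra! hcon
        exact hv.2 (hmax v hv.1 hvB hcon)
      obtain ⟨u, hu, hvu⟩ := this
      have := dg_lt_card hu hvu
      rw [ind_of_mem hvB]; exact this
    · rw [ind_of_notMem hvB]; exact dg_le_card _ _
  · intro v hv hn
    have h3 : dg G K v = 0 := dg_eq_zero fun u hu ha => hn ⟨u, hu, ha⟩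
    have h4 := ind_le_one B v
    omega
  · have hAK := h1.2.2.1 rfl
    obtain ⟨a, haU, haA⟩ := h.meets.1
    have haK := hAK a haA haU
    by_cases hk : k ≤ K.card
    · refine adm_of_lens (m := K.card) (c := α a) (d := 1) (.inl rfl) (fun j hj => ?_) hk
      obtain ⟨b, hb, hp⟩ := hK.path haK hj
      exact ⟨a, haA, b, hKB b hb, j, hp.mono hKU, by ring⟩
    · refine h.clique_peel hK hKU hΔK haK haA hAK ?_
      by_contra hemp
      rw [Finset.not_nonempty_iff_eq_empty, Finset.sdiff_eq_empty_iff_subset] at hemp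
      obtain rfl := subset_antisymm hemp hKU
      obtain ⟨v, hv⟩ := h.ne
      have h3 := h.deg v hv
      have h4 := ind_le_one A v
      have h5 := ind_le_one B v
      have h6 := dg_lt_card (G := G) (Finset.mem_sdiff.1 hv).1 (G.loopless.irrefl v)
      omega

theorem Inst.single_case (h : Inst G U ∅ A B k)
    (hB : ∀ u ∈ U, u ∈ B → ∀ v ∈ U, v ∈ B → ¬ G.Adj u v)
    (hone : ∀ W ⊆ U, (∀ v ∈ W, v ∈ B) → ∀ v ∈ U, v ∉ B → dg G W v ≤ 1) :
    Adm k (Val G U A α B) := by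
  classical
  set W := U.filter (· ∈ B) with hWdef
  have hWU : W ⊆ U := Finset.filter_subset _ _
  have hWB : ∀ v ∈ W, v ∈ B := fun v hv => (Finset.mem_filter.1 hv).2
  have hnB : ∀ v ∈ U \ W, v ∈ U ∧ v ∉ B := fun v hv => by
    rw [Finset.mem_sdiff] at hv
    exact ⟨hv.1, fun hB => hv.2 (Finset.mem_filter.2 ⟨hv.1, hB⟩)⟩
  refine (adm_or_obstruction (α := α) (m := 1) (m' := 1) (W := W) (T := W) (c := 0) (c' := 0) (d := 1)
    (d' := 1) h.IH h.conn (fun b D hD _ => h.strong b D hD (by simp)) hWU subset_rfl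
    ?_ le_rfl le_rfl (.inl rfl) (.inl rfl) ?_ (by simp) ?_ ?_
    (by simp) (fun v hv => h.deg' (hnB v hv).1)).elim id fun h1 => ?_
  · obtain ⟨b, hb, hbB⟩ := h.meets.2
    exact ⟨b, Finset.mem_filter.2 ⟨hb, hbB⟩⟩
  · intro κ hκ j hj
    obtain rfl : j = 0 := by omega
    exact ⟨κ, hWB κ hκ, .nil hκ⟩
  · intro v hv _
    rw [ind_of_notMem (hnB v hv).2]
    exact hone W hWU hWB v (hnB v hv).1 (hnB v hv).2
  · intro v hv hn
    have h3 : dg G W v = 0 := dg_eq_zero fun u hu ha => hn ⟨u, hu, ha⟩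
    rw [ind_of_notMem (hnB v hv).2]
    omega
  · have hAW := h1.2.2.1 rfl
    obtain ⟨a, haU, haA⟩ := h.meets.1
    refine h.peel haU haA fun v hv hvA => ?_
    exact hB v hv (hWB v (hAW v hvA hv)) a haU (hWB a (hAW a haA haU))

end Reductions

section Theta

variable {V : Type*} [DecidableEq V] {G : SimpleGraph V} [DecidableRel G.Adj]
variable {U : Finset V} {A B : Set V} {α : V → ℕ} {k : ℕ}

/-- A clique `K` outside `B` completely joined to a nonempty set `Θ` of at most two terminals. -/
structure Theta (G : SimpleGraph V) (U : Finset V) (B : Set V) (K Θ : Finset V) : Prop where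
  KU : K ⊆ U
  KB : ∀ v ∈ K, v ∉ B
  clq : Clq G K
  two : 2 ≤ K.card
  ΘU : Θ ⊆ U
  ΘB : ∀ v ∈ Θ, v ∈ B
  adj : ∀ u ∈ K, ∀ t ∈ Θ, G.Adj u t
  pos : 1 ≤ Θ.card
  le : Θ.card ≤ 2

theorem Theta.disj {K Θ : Finset V} (t : Theta G U B K Θ) : Disjoint K Θ :=
  Finset.disjoint_left.2 fun v hv h => t.KB v hv (t.ΘB v h)

theorem Theta.core {K Θ : Finset V} (h : Inst G U ∅ A B k) (t : Theta G U B K Θ)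
    (hB : ∀ u ∈ U, u ∈ B → ∀ v ∈ U, v ∈ B → ¬ G.Adj u v)
    (hmax : ∀ v ∈ U, v ∉ B → v ∉ K → ¬ ((∀ u ∈ K, G.Adj v u) ∧ ∀ u ∈ Θ, G.Adj v u))
    (h1 : Θ.card = 1 → ∀ v ∈ U, v ∈ B → v ∉ Θ → ¬ ∀ u ∈ K, G.Adj v u) :
    Adm k (Val G U A α B) ∨
      ((∀ C ⊆ U \ (K ∪ Θ), Conn G C → Clo G (U \ (K ∪ Θ)) C → Meets C A →
          ¬ Meets C (nbs G K)) ∧ ((∃ a ∈ K, a ∈ A) ∨ ∀ a ∈ A, a ∈ U → a ∈ K ∪ Θ) ∧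
        (2 ≤ Θ.card → ∀ a ∈ A, a ∈ U → a ∈ K ∪ Θ)) := by
  have hpos := t.pos
  have h2 := t.two
  have hle := t.le
  have hWK : (K ∪ Θ) \ K = Θ := by
    rw [Finset.union_sdiff_left, Finset.sdiff_eq_self_iff_disjoint]; exact t.disj.symm
  have hWU : K ∪ Θ ⊆ U := Finset.union_subset t.KU t.ΘU
  have hWc : (K ∪ Θ).card = K.card + Θ.card := Finset.card_union_of_disjoint t.disj
  have hv' : ∀ v ∈ U \ (K ∪ Θ), v ∈ U ∧ v ∉ K ∧ v ∉ Θ := fun v hv => by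
    simpa [not_or] using hv
  have hdB : ∀ v ∈ U, v ∈ B → dg G (K ∪ Θ) v ≤ dg G K v := fun v hv hvB => by
    refine dg_le_of fun u hu ha => ?_
    rcases Finset.mem_union.1 hu with hu | hu
    · exact hu
    · exact absurd ha (hB v hv hvB u (t.ΘU hu) (t.ΘB u hu))
  refine (adm_or_obstruction (α := α) (m := K.card + Θ.card - 1) (m' := Θ.card) (W := K ∪ Θ) (T := K)
    (c := 1) (c' := 0) (d := 1) (d' := 2) h.IH h.conn
    (fun b D hD _ => h.strong b D hD (by simp)) hWU Finset.subset_union_left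
    (Finset.card_pos.1 (by omega)) (by omega) hpos (.inl rfl) (.inr rfl) ?_ ?_ ?_ ?_ ?_
    (fun v hv => h.deg' (hv' v hv).1)).imp id (fun h => ⟨h.1, h.2.1, h.2.2.2⟩)
  · intro κ hκ j hj
    obtain ⟨b, hb, hp⟩ := clique_join_path t.clq t.disj t.adj hκ h2 hpos hle hj
    exact ⟨b, t.ΘB b hb, hp.symm⟩
  · rw [hWK]
    intro z hz j hj
    have hzW : z ∈ K ∪ Θ := Finset.mem_union_right _ hz
    by_cases hj0 : j = 0
    · subst hj0
      exact ⟨z, t.ΘB z hz, .nil hzW⟩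
    · obtain rfl : j = 1 := by omega
      obtain ⟨z', hz', hne⟩ := Finset.exists_mem_ne (by omega : 1 < Θ.card) z
      obtain ⟨κ, hκ⟩ := Finset.card_pos.1 (by omega : 0 < K.card)
      refine ⟨z', t.ΘB z' hz', .cons (Finset.mem_union_right _ hz') (t.adj κ hκ z' hz').symm
        (.cons (Finset.mem_erase.2 ⟨(t.adj κ hκ z' hz').ne, Finset.mem_union_left _ hκ⟩)
          (t.adj κ hκ z hz) (.nil ?_))⟩
      exact Finset.mem_erase.2 ⟨(t.adj κ hκ z hz).ne', Finset.mem_erase.2 ⟨hne.symm, hzW⟩⟩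
  · intro v hv _
    obtain ⟨hvU, hvK, hvΘ⟩ := hv' v hv
    by_cases hvB : v ∈ B
    · rw [ind_of_mem hvB]
      have e1 := hdB v hvU hvB
      have e2 := dg_le_card (G := G) K v
      by_cases hΘ : Θ.card = 1
      · have := h1 hΘ v hvU hvB hvΘ
        push Not at this
        obtain ⟨u, hu, hvu⟩ := this
        have := dg_lt_card hu hvu
        omega
      · omega
    · rw [ind_of_notMem hvB]
      have : ∃ u ∈ K ∪ Θ, ¬ G.Adj v u := by
        by_contra! hcon
        exact hmax v hvU hvB hvK ⟨fun u hu => hcon u (Finset.mem_union_left _ hu),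
          fun u hu => hcon u (Finset.mem_union_right _ hu)⟩
      obtain ⟨u, hu, hvu⟩ := this
      have := dg_lt_card hu hvu
      omega
  · intro v hv hn
    obtain ⟨hvU, hvK, hvΘ⟩ := hv' v hv
    have e0 : dg G K v = 0 := dg_eq_zero fun u hu ha => hn ⟨u, hu, ha⟩
    by_cases hvB : v ∈ B
    · have := hdB v hvU hvB
      rw [ind_of_mem hvB]
      omega
    · rw [ind_of_notMem hvB]
      have e1 := dg_union (G := G) (U := K) (W := Θ) v
      have e2 := dg_le_card (G := G) Θ v
      omega
  · rw [hWK]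
    exact fun h => h.le

theorem Theta.direct {K Θ : Finset V} (t : Theta G U B K Θ) {a : V} (haK : a ∈ K) (haA : a ∈ A)
    (hk : k ≤ K.card + Θ.card - 1) : Adm k (Val G U A α B) := by
  refine adm_of_lens (m := K.card + Θ.card - 1) (c := α a + 1) (d := 1) (.inl rfl)
    (fun j hj => ?_) hk
  obtain ⟨b, hb, hp⟩ := clique_join_path t.clq t.disj t.adj haK t.two t.pos t.le hj
  exact ⟨a, haA, b, t.ΘB b hb, _, hp.mono (Finset.union_subset t.KU t.ΘU), by ring⟩

theorem Theta.case_two {K Θ : Finset V} (h : Inst G U ∅ A B k) (t : Theta G U B K Θ)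
    (hΘ2 : Θ.card = 2)
    (hB : ∀ u ∈ U, u ∈ B → ∀ v ∈ U, v ∈ B → ¬ G.Adj u v)
    (hmax : ∀ v ∈ U, v ∉ B → v ∉ K → ¬ ((∀ u ∈ K, G.Adj v u) ∧ ∀ u ∈ Θ, G.Adj v u)) :
    Adm k (Val G U A α B) := by
  classical
  rcases t.core (α := α) h hB hmax (fun h => by omega) with hc | ⟨-, -, hAW⟩
  · exact hc
  replace hAW := hAW hΘ2.ge
  by_cases hAK : ∃ a ∈ K, a ∈ A
  swap
  · push Not at hAK
    have hAB : ∀ v ∈ A, v ∈ U → v ∈ B := fun v hv hvU =>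
      (Finset.mem_union.1 (hAW v hv hvU)).elim (fun h' => absurd hv (hAK v h')) (t.ΘB v)
    obtain ⟨a, haU, haA⟩ := h.meets.1
    exact h.peel haU haA fun v hv hvA => hB v hv (hAB v hvA hv) a haU (hAB a haA haU)
  obtain ⟨a, haK, haA⟩ := hAK
  by_cases hk : k ≤ K.card + Θ.card - 1
  · exact t.direct haK haA hk
  have hK2 := t.two
  have haU := t.KU haK
  have haB := t.KB a haK
  have hWU : K ∪ Θ ⊆ U := Finset.union_subset t.KU t.ΘU
  have hWc : (K ∪ Θ).card = K.card + Θ.card := Finset.card_union_of_disjoint t.disj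
  have hout : (U \ (K ∪ Θ)).Nonempty := by
    by_contra hemp
    rw [Finset.not_nonempty_iff_eq_empty, Finset.sdiff_eq_empty_iff_subset] at hemp
    have h1 := h.deg' haU
    have h2 := ind_le_one A a
    rw [ind_of_notMem haB] at h1
    have h3 := dg_mono (G := G) hemp a
    have h4 := dg_lt_card (G := G) (Finset.mem_union_left Θ haK) (G.loopless.irrefl a)
    omega
  obtain ⟨x, y, hxy, hΘ⟩ := Finset.card_eq_two.1 hΘ2
  have hx : x ∈ Θ := by simp [hΘ]
  have hy : y ∈ Θ := by simp [hΘ]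
  have hxU := t.ΘU hx
  have hxB := t.ΘB x hx
  have hax : a ≠ x := (t.adj a haK x hx).ne
  set U' := (U.erase a).erase x with hU'
  have hU'U : U' ⊆ U := (Finset.erase_subset _ _).trans (Finset.erase_subset _ _)
  have hmU' : ∀ v, v ∈ U' ↔ v ≠ x ∧ v ≠ a ∧ v ∈ U := fun v => by
    simp [hU']
  have hDx : ∀ D ⊆ U', x ∉ D ∧ a ∉ D := fun D hD =>
    ⟨fun h' => ((hmU' x).1 (hD h')).1 rfl, fun h' => ((hmU' a).1 (hD h')).2.1 rfl⟩
  have hya : ∀ v ∈ insert y (K.erase a), G.Adj v a ∧ v ≠ x ∧ v ∈ K ∪ Θ := by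
    intro v hv
    rcases Finset.mem_insert.1 hv with rfl | hv
    · exact ⟨(t.adj a haK v hy).symm, hxy.symm, Finset.mem_union_right _ hy⟩
    · rw [Finset.mem_erase] at hv
      refine ⟨t.clq v hv.2 a haK hv.1, ?_, Finset.mem_union_left _ hv.2⟩
      rintro rfl
      exact t.KB v hv.2 hxB
  have hWΔ : ∀ v ∈ K ∪ Θ, v ≠ x → v ≠ a → v ∈ insert y (K.erase a) := by
    intro v hv hvx hva
    rcases Finset.mem_union.1 hv with hv | hv
    · exact Finset.mem_insert_of_mem (Finset.mem_erase.2 ⟨hva, hv⟩)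
    · rw [hΘ, Finset.mem_insert, Finset.mem_singleton] at hv
      exact Finset.mem_insert.2 (.inl (hv.resolve_left hvx))
  have hycard : (insert y (K.erase a)).card = K.card := by
    rw [Finset.card_insert_of_notMem, Finset.card_erase_of_mem haK]
    · omega
    · exact fun h' => t.KB y (Finset.mem_of_mem_erase h') (t.ΘB y hy)
  have key := h.IH U' ?_ (insert y (K.erase a)) {v | v ∈ B ∨ G.Adj v x}
    (fun v => if G.Adj v x then 1 else 0) (nbs G {a}) k ?_ ?_ ?_ ?_ ?_ (by omega) ?_
  · refine key.shift (α a + 1) ?_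
    rintro n ⟨v, hv, w, hw, l, hl, rfl⟩
    rw [mem_nbs_singleton] at hw
    have hp : PIn G (U.erase x) a v (l + 1) := by
      refine .cons (Finset.mem_erase.2 ⟨hax, haU⟩) hw.symm (hl.symm.mono ?_)
      rw [hU', Finset.erase_right_comm]
    by_cases hvx : G.Adj v x
    · refine ⟨a, haA, x, hxB, _, (PIn.cons hxU hvx.symm hp.symm).symm, ?_⟩
      simp only [if_pos hvx]; ring
    · refine ⟨a, haA, v, hv.resolve_right hvx, _, hp.mono (Finset.erase_subset _ _), ?_⟩
      simp only [if_neg hvx]; ring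
  · exact (Finset.card_erase_le).trans_lt (Finset.card_erase_lt_of_mem haU)
  · have hE : ∀ D ⊆ U', ∀ b, CloX G U' D b → ¬ Meets D {v | v ∈ B ∨ G.Adj v x} →
        ¬ Meets D (nbs G {a}) → CloX G U D b := by
      intro D hD b hX hn1 hn2 v hv u hu hvu
      refine hX v hv u ((hmU' u).2 ⟨?_, ?_, hu⟩) hvu
      · rintro rfl; exact hn1 ⟨v, hv, .inr hvu⟩
      · rintro rfl; exact hn2 ⟨v, hv, mem_nbs_singleton.2 hvu⟩
    constructor
    · intro D hD hne hcl
      obtain ⟨hxD, haD⟩ := hDx D hD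
      constructor
      · by_contra hn
        obtain ⟨v, hv, hvB⟩ := (h.strong' a D (hD.trans hU'U) hne haD (fun v hv u hu hvu => by
          by_cases hua : u = a
          · exact .inr hua
          · refine .inl (hcl v hv u ((hmU' u).2 ⟨?_, hua, hu⟩) hvu)
            rintro rfl; exact hn ⟨v, hv, .inr hvu⟩)).2
        exact hn ⟨v, hv, .inl hvB⟩
      · by_contra hn
        obtain ⟨v, hv, hvA⟩ := (h.strong' x D (hD.trans hU'U) hne hxD (fun v hv u hu hvu => by
          by_cases hux : u = x
          · exact .inr hux
          · refine .inl (hcl v hv u ((hmU' u).2 ⟨hux, ?_, hu⟩) hvu)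
            rintro rfl; exact hn ⟨v, hv, mem_nbs_singleton.2 hvu⟩)).1
        have hv' := (hmU' v).1 (hD hv)
        exact hn ⟨v, hv, mem_nbs_singleton.2
          (hya v (hWΔ v (hAW v hvA hv'.2.2) hv'.1 hv'.2.1)).1⟩
    · intro b D hD hne hb hX
      by_contra! hcon
      obtain ⟨v, hv, hvB⟩ := (h.strong' b D (hD.trans hU'U) hne hb (hE D hD b hX hcon.1 hcon.2)).2
      exact hcon.1 ⟨v, hv, .inl hvB⟩
  · refine hout.mono fun v hv => ?_
    rw [Finset.mem_sdiff] at hv ⊢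
    refine ⟨(hmU' v).2 ⟨?_, ?_, hv.1⟩, fun h' => hv.2 (hya v h').2.2⟩
    · rintro rfl; exact hv.2 (Finset.mem_union_right _ hx)
    · rintro rfl; exact hv.2 (Finset.mem_union_left _ haK)
  · intro v hv
    have := hya v hv
    exact (hmU' v).2 ⟨this.2.1, this.1.ne, hWU this.2.2⟩
  · exact (t.clq.subset (Finset.erase_subset _ _)).insert
      fun u hu => (t.adj u (Finset.mem_of_mem_erase hu) y hy).symm
  · exact fun v hv => mem_nbs_singleton.2 (hya v hv).1
  · intro _ v hv
    rw [Finset.mem_sdiff, hmU'] at hv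
    have hvW : v ∉ K ∪ Θ := fun h' => hv.2 (hWΔ v h' hv.1.1 hv.1.2.1)
    have h1 := h.deg' hv.1.2.2
    rw [ind_of_notMem fun h' => hvW (hAW v h' hv.1.2.2)] at h1
    have h2 := dg_erase_le (G := G) U a v
    have h3 := dg_erase_le (G := G) (U.erase a) x v
    have h4 : ind (nbs G {x}) v + ind B v ≤ ind {v | v ∈ B ∨ G.Adj v x} v := by
      have e1 := ind_le_one (nbs G {x}) v
      by_cases hvB : v ∈ B
      · rw [ind_of_mem (show v ∈ {v | v ∈ B ∨ G.Adj v x} from .inl hvB), ind_of_mem hvB,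
          ind_of_notMem fun h' => hB v hv.1.2.2 hvB x hxU hxB (mem_nbs_singleton.1 h')]
      · rw [ind_of_notMem hvB]
        by_cases hvx : G.Adj v x
        · rw [ind_of_mem (show v ∈ {v | v ∈ B ∨ G.Adj v x} from .inr hvx)]; omega
        · rw [ind_of_notMem fun h' => hvx (mem_nbs_singleton.1 h')]; omega
    rw [← hU'] at h3
    omega

theorem Theta.case_one {K Θ : Finset V} (h : Inst G U ∅ A B k) (t : Theta G U B K Θ)
    (hΘ1 : Θ.card = 1)
    (hB : ∀ u ∈ U, u ∈ B → ∀ v ∈ U, v ∈ B → ¬ G.Adj u v)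
    (hmax : ∀ v ∈ U, v ∉ B → v ∉ K → ¬ ((∀ u ∈ K, G.Adj v u) ∧ ∀ u ∈ Θ, G.Adj v u))
    (h1 : ∀ v ∈ U, v ∈ B → v ∉ Θ → ¬ ∀ u ∈ K, G.Adj v u) :
    Adm k (Val G U A α B) := by
  classical
  rcases t.core (α := α) h hB hmax (fun _ => h1) with hc | ⟨hno, -, -⟩
  · exact hc
  have hK2 := t.two
  obtain ⟨x, hΘ⟩ := Finset.card_eq_one.1 hΘ1
  have hx : x ∈ Θ := by simp [hΘ]
  have hxU := t.ΘU hx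
  have hxB := t.ΘB x hx
  have hxK : x ∉ K := fun h' => t.KB x h' hxB
  have hKx : K ⊆ U.erase x := fun v hv => Finset.mem_erase.2
    ⟨fun e => hxK (e ▸ hv), t.KU hv⟩
  obtain ⟨κ, hκ⟩ := Finset.card_pos.1 (by omega : 0 < K.card)
  have hWU : K ∪ Θ ⊆ U := Finset.union_subset t.KU t.ΘU
  have hWmem : ∀ v ∈ K ∪ Θ, v ≠ x → v ∈ K := fun v hv hvx => by
    rcases Finset.mem_union.1 hv with hv | hv
    · exact hv
    · exact absurd (by simpa [hΘ] using hv) hvx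
  by_cases hAW : ∀ a ∈ A, a ∈ U → a ∈ K ∪ Θ
  · have hS := h.strong' x (U.erase x) (Finset.erase_subset _ _) ⟨κ, hKx hκ⟩
      (Finset.notMem_erase _ _) (cloX_of_erase (Clo.self _))
    obtain ⟨⟨a, ha, haA⟩, b, hb, hbB⟩ := hS
    rw [Finset.mem_erase] at ha hb
    have haK : a ∈ K := hWmem a (hAW a haA ha.2) ha.1
    by_cases hk : k ≤ K.card + Θ.card - 1
    · exact t.direct haK haA hk
    · refine h.clique_peel (K := insert x K)
        (t.clq.insert fun u hu => (t.adj u hu x hx).symm)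
        (Finset.insert_subset hxU t.KU) (by simp) (Finset.mem_insert_of_mem haK) haA ?_ ?_
      · intro v hv hvU
        by_cases e : v = x
        · simp [e]
        · exact Finset.mem_insert_of_mem (hWmem v (hAW v hv hvU) e)
      · refine ⟨b, Finset.mem_sdiff.2 ⟨hb.2, fun h' => ?_⟩⟩
        exact t.KB b ((Finset.mem_insert.1 h').resolve_left hb.1) hbB
  push Not at hAW
  obtain ⟨r, hrA, hrU, hrW⟩ := hAW
  obtain ⟨R, hR, hκR, hRcl, hRcon⟩ := exists_comp (G := G) (hKx hκ)
  have hRU : R ⊆ U := hR.trans (Finset.erase_subset _ _)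
  have hxR : x ∉ R := fun h' => Finset.notMem_erase x U (hR h')
  have hRX : CloX G U R x := cloX_of_erase hRcl
  have hKR : K ⊆ R := fun v hv => by
    by_cases e : v = κ
    · exact e ▸ hκR
    · exact hRcl κ hκR v (hKx hv) (t.clq κ hκ v hv (Ne.symm e))
  have hcomp : ∀ a ∈ A, a ∈ U → a ∉ K ∪ Θ → ∃ C ⊆ U \ (K ∪ Θ), a ∈ C ∧ Conn G C ∧
      CloX G U C x ∧ Disjoint C R := by
    intro a ha haU haW
    obtain ⟨C, hC, haC, hcl, hcon⟩ := exists_comp (G := G) (Finset.mem_sdiff.2 ⟨haU, haW⟩)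
    have hn := hno C hC hcon hcl ⟨a, haC, ha⟩
    have hCX : CloX G U C x := by
      intro v hv u hu hvu
      by_cases huW : u ∈ K ∪ Θ
      · by_cases hux : u = x
        · exact .inr hux
        · exact absurd ⟨v, hv, u, hWmem u huW hux, hvu⟩ hn
      · exact .inl (hcl v hv u (Finset.mem_sdiff.2 ⟨hu, huW⟩) hvu)
    refine ⟨C, hC, haC, hcon, hCX, ?_⟩
    by_contra hd
    rw [Finset.not_disjoint_iff] at hd
    obtain ⟨y, hyC, hyR⟩ := hd
    have := hRcon (R ∩ C) Finset.inter_subset_left ⟨y, Finset.mem_inter.2 ⟨hyR, hyC⟩⟩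
      (fun v hv u hu ha => by
        rw [Finset.mem_inter] at hv ⊢
        refine ⟨hu, (hCX v hv.2 u (hRU hu) ha).resolve_right ?_⟩
        rintro rfl; exact hxR hu)
    rw [← this] at hκR
    exact (Finset.mem_sdiff.1 (hC (Finset.mem_inter.1 hκR).2)).2 (Finset.mem_union_left _ hκ)
  have hRA : ∀ v ∈ R, v ∈ A → v ∈ K := by
    intro v hv hvA
    refine hWmem v ?_ fun e => hxR (e ▸ hv)
    by_contra hvW
    obtain ⟨C, -, hvC, -, -, hd⟩ := hcomp v hvA (hRU hv) hvW
    exact Finset.disjoint_left.1 hd hvC hv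
  obtain ⟨C, hC, hrC, hCcon, hCX, hCR⟩ := hcomp r hrA hrU hrW
  have hCU : C ⊆ U := hC.trans Finset.sdiff_subset
  have hxC : x ∉ C := fun h' =>
    (Finset.mem_sdiff.1 (hC h')).2 (Finset.mem_union_right _ hx)
  have hCx : Meets C (nbs G {x}) := by
    by_contra hn
    have := h.conn C hCU ⟨r, hrC⟩ (fun v hv u hu hvu => by
      refine (hCX v hv u hu hvu).resolve_right ?_
      rintro rfl; exact hn ⟨v, hv, mem_nbs_singleton.2 hvu⟩)
    exact hxC (this ▸ hxU)
  obtain ⟨c, hcC, hcx⟩ := hCx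
  obtain ⟨n, hn⟩ := hCcon.path hrC hcC
  have hexit : PIn G (insert x C) r x (n + 0 + 1) :=
    hn.join (mem_nbs_singleton.1 hcx) (.nil (Finset.mem_singleton_self x))
      (Finset.disjoint_singleton_right.2 hxC) (Finset.subset_insert _ _) (by simp)
  have key := h.IH R (Finset.card_lt_card ⟨hRU, fun h' => hxR (h' hxU)⟩) K B
    (fun _ => 0) (nbs G {x}) k ?_ ?_ hKR t.clq
    (fun v hv => mem_nbs_singleton.2 (t.adj v hv x hx)) (by simp) ?_
  · refine key.shift (α r + n + 2) ?_
    rintro _ ⟨b, hb, w, hw, l, hl, rfl⟩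
    refine ⟨r, hrA, b, hb, _, hexit.join (mem_nbs_singleton.1 hw).symm hl.symm ?_
      (Finset.insert_subset hxU hCU) hRU, by ring⟩
    rw [Finset.disjoint_insert_left]
    exact ⟨hxR, hCR⟩
  · constructor
    · intro D hD hne hcl
      obtain rfl := hRcon D hD hne hcl
      exact ⟨(h.strong' x D hRU hne hxR hRX).2, κ, hκR,
        mem_nbs_singleton.2 (t.adj κ hκ x hx)⟩
    · intro b D hD hne hb hX
      by_contra! hcon
      refine hcon.1 (h.strong' b D (hD.trans hRU) hne hb fun v hv u hu hvu => ?_).2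
      rcases hRX v (hD hv) u hu hvu with h' | rfl
      · exact hX v hv u h' hvu
      · exact absurd ⟨v, hv, mem_nbs_singleton.2 hvu⟩ hcon.2
  · obtain ⟨b, hb, hbB⟩ := (h.strong' x R hRU ⟨κ, hκR⟩ hxR hRX).2
    exact ⟨b, Finset.mem_sdiff.2 ⟨hb, fun h' => t.KB b h' hbB⟩⟩
  · intro _ v hv
    rw [Finset.mem_sdiff] at hv
    have e1 := h.deg' (hRU hv.1)
    rw [ind_of_notMem fun h' => hv.2 (hRA v hv.1 h')] at e1
    have e2 : dg G U v ≤ dg G R v + dg G {x} v :=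
      dg_le_add fun u hu ha => by simpa using hRX v hv.1 u hu ha
    have e3 := dg_singleton_le (G := G) x v
    omega

end Theta

section Bip

variable {V : Type*} [DecidableEq V] {G : SimpleGraph V} [DecidableRel G.Adj]
variable {U : Finset V} {A B : Set V} {α : V → ℕ} {k : ℕ}

theorem good_entry {D Y : Finset V} {b : V} {m : ℕ} (h : Inst G U ∅ A B k) (hDU : D ⊆ U)
    (hDA : ∀ v ∈ D, v ∉ A) (hbD : b ∉ D)
    (hN : ∀ v ∈ D, ∀ u ∈ U, G.Adj v u → u ∈ D ∨ u = b ∨ u ∈ Y)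
    (hb : ∀ D' ⊆ D, D'.Nonempty → Clo G D D' → Meets D' (nbs G {b})) :
    Good G D (entry G Y B m) (nbs G {b}) := by
  constructor
  · intro D' hD' hne hcl
    refine ⟨?_, hb D' hD' hne hcl⟩
    by_contra hn
    obtain ⟨v, hv, hvA⟩ := (h.strong' b D' (hD'.trans hDU) hne (fun h' => hbD (hD' h'))
      fun v hv u hu hvu => by
        rcases hN v (hD' hv) u hu hvu with h1 | h1 | h1
        · exact .inl (hcl v hv u h1 hvu)
        · exact .inr h1
        · exact absurd ⟨v, hv, .inl ⟨u, h1, hvu⟩⟩ hn).1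
    exact hDA v (hD' hv) hvA
  · intro b' D' hD' hne hb' hX
    by_contra! hcon
    obtain ⟨v, hv, hvA⟩ := (h.strong' b' D' (hD'.trans hDU) hne hb'
      fun v hv u hu hvu => by
        rcases hN v (hD' hv) u hu hvu with h1 | rfl | h1
        · exact hX v hv u h1 hvu
        · exact absurd ⟨v, hv, mem_nbs_singleton.2 hvu⟩ hcon.2
        · exact absurd ⟨v, hv, .inl ⟨u, h1, hvu⟩⟩ hcon.1).1
    exact hDA v (hD' hv) hvA

/-- a maximal complete bipartite configuration between non-terminals `P` and terminals `T` -/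
structure Bip (G : SimpleGraph V) [DecidableRel G.Adj] (U : Finset V) (B : Set V) (P T : Finset V) : Prop where
  PU : P ⊆ U
  PB : ∀ v ∈ P, v ∉ B
  Pne : P.Nonempty
  TU : T ⊆ U
  TB : ∀ v ∈ T, v ∈ B
  adj : ∀ p ∈ P, ∀ t ∈ T, G.Adj p t
  full : ∀ v ∈ U, v ∈ B → (∀ p ∈ P, G.Adj v p) → v ∈ T
  card : P.card + 1 ≤ T.card
  max : ∀ v ∈ U, v ∉ B → v ∉ P → dg G T v ≤ P.card + 1

theorem Bip.case {P T : Finset V} (h : Inst G U ∅ A B k) (t : Bip G U B P T)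
    (hB : ∀ u ∈ U, u ∈ B → ∀ v ∈ U, v ∈ B → ¬ G.Adj u v)
    (htri : ∀ b ∈ U, b ∈ B → ∀ u ∈ U, ∀ v ∈ U, G.Adj u b → G.Adj v b → ¬ G.Adj u v) :
    Adm k (Val G U A α B) := by
  classical
  have hPpos : 1 ≤ P.card := Finset.card_pos.2 t.Pne
  have hTc := t.card
  have hdisj : Disjoint P T := Finset.disjoint_left.2 fun v hv h' => t.PB v hv (t.TB v h')
  have hWT : (P ∪ T) \ T = P := by
    rw [Finset.union_sdiff_right, Finset.sdiff_eq_self_iff_disjoint]; exact hdisj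
  have hWU : P ∪ T ⊆ U := Finset.union_subset t.PU t.TU
  have hv' : ∀ v ∈ U \ (P ∪ T), v ∈ U ∧ v ∉ P ∧ v ∉ T := fun v hv => by
    simpa [not_or] using hv
  have hPind : ∀ u ∈ P, ∀ v ∈ P, ¬ G.Adj u v := by
    obtain ⟨x, hx⟩ := Finset.card_pos.1 (by omega : 0 < T.card)
    exact fun u hu v hv => htri x (t.TU hx) (t.TB x hx) u (t.PU hu) v (t.PU hv)
      (t.adj u hu x hx) (t.adj v hv x hx)
  -- vertices touching `T`
  have htouch : ∀ v ∈ U, v ∈ nbs G T → v ∉ B ∧ ∀ p ∈ P, ¬ G.Adj v p := by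
    rintro v hvU ⟨x, hx, hvx⟩
    exact ⟨fun hvB => hB v hvU hvB x (t.TU hx) (t.TB x hx) hvx, fun p hp =>
      htri x (t.TU hx) (t.TB x hx) v hvU p (t.PU hp) hvx (t.adj p hp x hx)⟩
  have hc1 : ∀ v ∈ U \ (P ∪ T), v ∈ nbs G T →
      dg G P v = 0 ∧ ind B v = 0 ∧ dg G T v ≤ P.card + 1 := by
    intro v hv hvT
    obtain ⟨hvU, hvP, -⟩ := hv' v hv
    obtain ⟨hvB, hnP⟩ := htouch v hvU hvT
    exact ⟨dg_eq_zero hnP, ind_of_notMem hvB, t.max v hvU hvB hvP⟩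
  have hc2 : ∀ v ∈ U \ (P ∪ T), v ∉ nbs G T → dg G T v = 0 ∧ dg G P v + ind B v ≤ P.card := by
    intro v hv hvT
    obtain ⟨hvU, -, hvT'⟩ := hv' v hv
    refine ⟨dg_eq_zero fun u hu ha => hvT ⟨u, hu, ha⟩, ?_⟩
    by_cases hvB : v ∈ B
    · have : ∃ p ∈ P, ¬ G.Adj v p := by
        by_contra! hcon
        exact hvT' (t.full v hvU hvB hcon)
      obtain ⟨p, hp, hvp⟩ := this
      rw [ind_of_mem hvB]
      exact dg_lt_card hp hvp
    · rw [ind_of_notMem hvB]; exact dg_le_card _ _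
  have hlensT : ∀ κ ∈ T, ∀ j < P.card + 1, ∃ b ∈ B, PIn G (P ∪ T) b κ (0 + 2 * j) := by
    intro κ hκ j hj
    obtain ⟨b, hb, hp⟩ := (bip_path hdisj t.adj).1 κ hκ (by omega) (by omega : j ≤ P.card)
    exact ⟨b, t.TB b hb, by simpa using hp.symm⟩
  have hcore := adm_or_obstruction (α := α) (m := P.card + 1) (m' := P.card) (W := P ∪ T) (T := T)
    (c := 0) (c' := 1) (d := 2) (d' := 2) h.IH h.conn
    (fun b D hD _ => h.strong b D hD (by simp)) hWU Finset.subset_union_right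
    (Finset.card_pos.1 (by omega)) (by omega) hPpos (.inr rfl) (.inr rfl) hlensT
    (by
      rw [hWT]
      intro p hp j hj
      obtain ⟨b, hb, hp⟩ := (bip_path hdisj t.adj).2 p hp (by omega) (by omega : j + 1 ≤ P.card)
      exact ⟨b, t.TB b hb, by rw [Nat.add_comm]; exact hp.symm⟩)
    (fun v hv hvT => by
      obtain ⟨e1, e2, e3⟩ := hc1 v hv hvT
      have := dg_union (G := G) (U := P) (W := T) v
      omega)
    (fun v hv hvT => by
      obtain ⟨e1, e2⟩ := hc2 v hv hvT
      have := dg_union (G := G) (U := P) (W := T) v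
      omega)
    (by rw [hWT]; exact fun h => h.le)
    (fun v hv => h.deg' (hv' v hv).1)
  rcases hcore with hc | ⟨hno, hAT, -, -⟩
  · exact hc
  by_cases hTA : ∃ a ∈ T, a ∈ A
  swap
  · have hAW := hAT.resolve_left hTA
    have hAP : ∀ v ∈ A, v ∈ U → v ∈ P := fun v hv hvU =>
      (Finset.mem_union.1 (hAW v hv hvU)).resolve_right fun h' => hTA ⟨v, h', hv⟩
    obtain ⟨a, haU, haA⟩ := h.meets.1
    exact h.peel haU haA fun v hv hvA => hPind v (hAP v hvA hv) a (hAP a haA haU)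
  obtain ⟨a, haT, haA⟩ := hTA
  by_cases hk : k ≤ P.card + 1
  · refine adm_of_lens (m := P.card + 1) (c := α a) (d := 2) (.inr rfl) (fun j hj => ?_) hk
    obtain ⟨b, hb, hp⟩ := hlensT a haT j hj
    exact ⟨a, haA, b, hb, _, hp.symm.mono hWU, by ring⟩
  have haU := t.TU haT
  have haB := t.TB a haT
  obtain ⟨x, hx, hxa⟩ : ∃ x ∈ U \ (P ∪ T), G.Adj x a := by
    by_contra! hcon
    have e1 := h.deg' haU
    have e2 := ind_le_one A a
    have e3 := ind_le_one B a
    have e4 : dg G U a ≤ dg G P a := dg_le_of fun u hu hau => by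
      by_contra huP
      by_cases huT : u ∈ T
      · exact hB a haU haB u hu (t.TB u huT) hau
      · exact hcon u (by simp [hu, huP, huT]) hau.symm
    have := dg_le_card (G := G) P a
    omega
  obtain ⟨D, hD, hxD, hDcl, hDcon⟩ := exists_comp (G := G) hx
  have hDU : D ⊆ U := hD.trans Finset.sdiff_subset
  have hDA : ∀ v ∈ D, v ∉ A := fun v hv hvA =>
    hno D hD hDcon hDcl ⟨v, hv, hvA⟩ ⟨x, hxD, a, haT, hxa⟩
  have hDW : Disjoint D (P ∪ T) :=
    Finset.disjoint_left.2 fun v hv => (Finset.mem_sdiff.1 (hD hv)).2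
  have haW : a ∈ P ∪ T := Finset.mem_union_right _ haT
  have haD : a ∉ D := fun h' => Finset.disjoint_left.1 hDW h' haW
  have haP : a ∉ P := fun h' => t.PB a h' haB
  have hDcard : ∀ D' ⊆ D, D'.card < U.card := fun D' hD' =>
    Finset.card_lt_card ⟨hD'.trans hDU, fun h' => haD (hD' (h' haU))⟩
  have hNW : ∀ v ∈ D, ∀ u ∈ U, G.Adj v u → u ∈ D ∨ u ∈ P ∪ T := by
    intro v hv u hu hvu
    by_cases h' : u ∈ P ∪ T
    · exact .inr h'
    · exact .inl (hDcl v hv u (Finset.mem_sdiff.2 ⟨hu, h'⟩) hvu)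
  have hTa : (T.erase a).card = T.card - 1 := Finset.card_erase_of_mem haT
  have hWa : P ∪ T.erase a ⊆ P ∪ T := Finset.union_subset_union_right (Finset.erase_subset _ _)
  have hWaU : P ∪ T.erase a ⊆ U := hWa.trans hWU
  have hDWa : Disjoint D (P ∪ T.erase a) := hDW.mono_right hWa
  have haWa : a ∉ P ∪ T.erase a := by simp [haP]
  have hlam : ∀ z ∈ P ∪ T.erase a, ∀ j < P.card, ∃ b₀ ∈ B,
      PIn G (P ∪ T.erase a) b₀ z ((if z ∈ P then 1 else 0) + 2 * j) := by
    intro z hz j hj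
    have hbp := bip_path (G := G) (j := j) (hdisj.mono_right (Finset.erase_subset a T))
      (fun p hp y hy => t.adj p hp y (Finset.mem_of_mem_erase hy))
    by_cases hzP : z ∈ P
    · obtain ⟨b, hb, hp⟩ := hbp.2 z hzP (by omega) (by omega)
      refine ⟨b, t.TB b (Finset.mem_of_mem_erase hb), ?_⟩
      rw [if_pos hzP, Nat.add_comm]
      exact hp.symm
    · obtain ⟨b, hb, hp⟩ := hbp.1 z ((Finset.mem_union.1 hz).resolve_left hzP) (by omega)
        (by omega)
      refine ⟨b, t.TB b (Finset.mem_of_mem_erase hb), ?_⟩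
      rw [if_neg hzP, Nat.zero_add]
      exact hp.symm
  have hlamP : ∀ z ∈ P, ∀ j < P.card, ∃ b₀ ∈ B, PIn G (P ∪ T.erase a) b₀ z (1 + 2 * j) := by
    intro z hz j hj
    have := hlam z (Finset.mem_union_left _ hz) j hj
    rwa [if_pos hz] at this
  have hsingle : PIn G {a} a a 0 := .nil (Finset.mem_singleton_self a)
  have hmeeta : ∀ D' ⊆ D, D'.Nonempty → Clo G D D' → Meets D' (nbs G {a}) := by
    intro D' hD' hne hcl
    obtain rfl := hDcon D' hD' hne hcl
    exact ⟨x, hxD, mem_nbs_singleton.2 hxa⟩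
  have hdeg : ∀ v ∈ D, k + 1 ≤ dg G U v + ind A v + ind B v := fun v hv => h.deg' (hDU hv)
  have hcountP : ∀ v ∈ D, dg G P v + ind B v + 1 ≤ P.card + ind (entry G P B P.card) v := by
    intro v hv
    by_cases hvT : v ∈ nbs G T
    · obtain ⟨e1, e2, -⟩ := hc1 v (hD hv) hvT
      omega
    · obtain ⟨-, e2⟩ := hc2 v (hD hv) hvT
      by_cases he : v ∈ entry G P B P.card
      · rw [ind_of_mem he]; omega
      · have e3 : dg G P v = 0 := dg_eq_zero fun u hu ha => he (.inl ⟨u, hu, ha⟩)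
        have e4 := ind_le_one B v
        by_cases e5 : P.card = 1
        · have : ind B v = 0 := ind_of_notMem fun h' => he (.inr ⟨e5, h'⟩)
          omega
        · omega
  have hNa : ∀ v ∈ D, ∀ u ∈ U, G.Adj v u → u ∈ D ∨ u = a ∨ u ∈ P ∪ T.erase a := by
    intro v hv u hu hvu
    rcases hNW v hv u hu hvu with h1 | h1
    · exact .inl h1
    · by_cases hua : u = a
      · exact .inr (.inl hua)
      · right; right
        simpa [hua] using h1
  by_cases hTs : T.card = P.card + 1
  · refine end_lens (U := U) (D := D) (E := {a}) (W' := P ∪ T.erase a) (WL := P ∪ T.erase a)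
      (Y := P ∪ T.erase a) (m := P.card) (lam := fun z => if z ∈ P then 1 else 0) (b := a)
      (h.IH D (hDcard D subset_rfl)) ⟨x, hxD⟩ hDU hWaU (Finset.singleton_subset_iff.2 haU)
      hDWa (Finset.disjoint_singleton_right.2 haD) (Finset.disjoint_singleton_right.2 haWa) hDA
      hNa (good_entry h hDU hDA haD hNa hmeeta) hPpos (.inr rfl) (fun v hv => ?_) hlam haA hsingle
      hdeg
    have e0 := dg_union (G := G) (U := P) (W := T.erase a) v
    have e7 := dg_mono (G := G) (Finset.erase_subset a T) v
    by_cases he : v ∈ entry G (P ∪ T.erase a) B P.card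
    · rw [ind_of_mem he]
      by_cases hvT : v ∈ nbs G T
      · obtain ⟨e1, e2, -⟩ := hc1 v (hD hv) hvT
        have := dg_le_card (G := G) (T.erase a) v
        omega
      · obtain ⟨e1, e2⟩ := hc2 v (hD hv) hvT
        omega
    · have e3 : dg G (P ∪ T.erase a) v = 0 := dg_eq_zero fun u hu ha => he (.inl ⟨u, hu, ha⟩)
      have e4 := ind_le_one B v
      by_cases e5 : P.card = 1
      · have : ind B v = 0 := ind_of_notMem fun h' => he (.inr ⟨e5, h'⟩)
        omega
      · omega
  by_cases hDT : ¬ Meets D (nbs G (T.erase a))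
  · have hNP : ∀ v ∈ D, ∀ u ∈ U, G.Adj v u → u ∈ D ∨ u = a ∨ u ∈ P := by
      intro v hv u hu hvu
      rcases hNa v hv u hu hvu with h1 | h1 | h1
      · exact .inl h1
      · exact .inr (.inl h1)
      · right; right
        refine (Finset.mem_union.1 h1).resolve_right fun h2 => hDT ⟨v, hv, u, h2, hvu⟩
    exact end_lens (U := U) (D := D) (E := {a}) (W' := P) (WL := P ∪ T.erase a)
      (Y := P) (m := P.card) (lam := fun _ => 1) (b := a)
      (h.IH D (hDcard D subset_rfl)) ⟨x, hxD⟩ hDU hWaU (Finset.singleton_subset_iff.2 haU)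
      hDWa (Finset.disjoint_singleton_right.2 haD) (Finset.disjoint_singleton_right.2 haWa) hDA
      hNP (good_entry h hDU hDA haD hNP hmeeta) hPpos (.inr rfl) hcountP hlamP haA hsingle
      hdeg
  push Not at hDT
  by_cases hviol : ∃ b, ∃ D' ⊆ D, D'.Nonempty ∧ b ∈ D ∧ b ∉ D' ∧ CloX G D D' b ∧
      ¬ Meets D' (nbs G T)
  · obtain ⟨b, D', hD', hne, hbD, hbD', hX, hnT⟩ := hviol
    have hNP : ∀ v ∈ D', ∀ u ∈ U, G.Adj v u → u ∈ D' ∨ u = b ∨ u ∈ P := by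
      intro v hv u hu hvu
      rcases hNW v (hD' hv) u hu hvu with h1 | h1
      · rcases hX v hv u h1 hvu with h2 | h2
        · exact .inl h2
        · exact .inr (.inl h2)
      · right; right
        refine (Finset.mem_union.1 h1).resolve_right fun h2 => hnT ⟨v, hv, u, h2, hvu⟩
    have hna : ¬ Meets D' (nbs G {a}) := by
      rintro ⟨v, hv, hva⟩
      exact hnT ⟨v, hv, a, haT, mem_nbs_singleton.1 hva⟩
    obtain ⟨y, hya, r, hr⟩ := link hDcon hD' hbD hbD' hX ⟨x, hxD, mem_nbs_singleton.2 hxa⟩ hna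
    have haDD : a ∉ D \ D' := fun h' => haD (Finset.mem_sdiff.1 h').1
    have hexit : PIn G (insert a (D \ D')) a b (r + 1) := by
      refine .cons (Finset.mem_insert_self _ _) (mem_nbs_singleton.1 hya).symm ?_
      rw [Finset.erase_insert haDD]
      exact hr
    refine end_lens (U := U) (D := D') (E := insert a (D \ D')) (W' := P) (WL := P ∪ T.erase a)
      (Y := P) (m := P.card) (lam := fun _ => 1) (b := b)
      (h.IH D' (hDcard D' hD')) hne (hD'.trans hDU) hWaU
      (Finset.insert_subset haU (Finset.sdiff_subset.trans hDU))
      (hDWa.mono_left hD') ?_ ?_ (fun v hv => hDA v (hD' hv))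
      hNP (good_entry h (hD'.trans hDU) (fun v hv => hDA v (hD' hv)) hbD' hNP ?_) hPpos (.inr rfl)
      (fun v hv => hcountP v (hD' hv)) hlamP haA hexit (fun v hv => hdeg v (hD' hv))
    · rw [Finset.disjoint_insert_right]
      exact ⟨fun h' => haD (hD' h'), Finset.disjoint_sdiff⟩
    · rw [Finset.disjoint_insert_right]
      exact ⟨haWa, hDWa.symm.mono_right Finset.sdiff_subset⟩
    · intro D1 hD1 hne1 hcl
      by_contra hn
      have := hDcon D1 (hD1.trans hD') hne1 (fun v hv u hu hvu => by
        rcases hX v (hD1 hv) u hu hvu with h1 | rfl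
        · exact hcl v hv u h1 hvu
        · exact absurd ⟨v, hv, mem_nbs_singleton.2 hvu⟩ hn)
      exact hbD' (hD1 (this ▸ hbD))
  · refine end_lens (U := U) (D := D) (E := {a}) (W' := P ∪ T.erase a) (WL := P ∪ T.erase a)
      (Y := T.erase a) (m := P.card + 1) (lam := fun _ => 0) (d := 2) (b := a)
      (h.IH D (hDcard D subset_rfl)) ⟨x, hxD⟩ hDU hWaU (Finset.singleton_subset_iff.2 haU)
      hDWa (Finset.disjoint_singleton_right.2 haD) (Finset.disjoint_singleton_right.2 haWa) hDA
      hNa ?_ (by omega) (.inr rfl) (fun v hv => ?_) ?_ haA hsingle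
      hdeg
    · constructor
      · intro D' hD' hne hcl
        obtain rfl := hDcon D' hD' hne hcl
        exact ⟨hDT.imp fun v hv => ⟨hv.1, .inl hv.2⟩, x, hxD, mem_nbs_singleton.2 hxa⟩
      · intro b D' hD' hne hb hX
        by_contra! hcon
        refine hviol ⟨b, D', hD', hne, ?_, hb, hX, ?_⟩
        · by_contra hbD
          exact hcon.2 (hmeeta D' hD' hne (hX.clo hbD))
        · rintro ⟨v, hv, y, hy, hvy⟩
          by_cases hya : y = a
          · exact hcon.2 ⟨v, hv, mem_nbs_singleton.2 (hya ▸ hvy)⟩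
          · exact hcon.1 ⟨v, hv, .inl ⟨y, Finset.mem_erase.2 ⟨hya, hy⟩, hvy⟩⟩
    · have e0 := dg_union (G := G) (U := P) (W := T.erase a) v
      have e7 := dg_mono (G := G) (Finset.erase_subset a T) v
      by_cases hvT : v ∈ nbs G T
      · obtain ⟨e1, e2, e3⟩ := hc1 v (hD hv) hvT
        by_cases he : v ∈ entry G (T.erase a) B (P.card + 1)
        · rw [ind_of_mem he]; omega
        · have e4 : dg G (T.erase a) v = 0 := dg_eq_zero fun u hu ha => he (.inl ⟨u, hu, ha⟩)
          omega
      · obtain ⟨e1, e2⟩ := hc2 v (hD hv) hvT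
        omega
    · intro z hz j hj
      obtain ⟨b, hb, hp⟩ := (bip_path (G := G) (j := j)
        (hdisj.mono_right (Finset.erase_subset a T))
        (fun p hp y hy => t.adj p hp y (Finset.mem_of_mem_erase hy))).1 z hz (by omega) (by omega)
      exact ⟨b, t.TB b (Finset.mem_of_mem_erase hb), by simpa using hp.symm⟩

end Bip

section Main

variable {V : Type*} [DecidableEq V] {G : SimpleGraph V} [DecidableRel G.Adj]
variable {U Δ : Finset V} {A B : Set V} {α : V → ℕ} {k : ℕ}

theorem exists_max_card {U : Finset V} {Q : Finset V → Prop} (hQ : ∀ K, Q K → K ⊆ U)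
    (h : ∃ K, Q K) : ∃ K, Q K ∧ ∀ L, Q L → L.card ≤ K.card := by
  classical
  obtain ⟨K, hK⟩ := h
  obtain ⟨M, hM, hmax⟩ := Finset.exists_max_image (U.powerset.filter Q) Finset.card
    ⟨K, Finset.mem_filter.2 ⟨Finset.mem_powerset.2 (hQ K hK), hK⟩⟩
  exact ⟨M, (Finset.mem_filter.1 hM).2, fun L hL =>
    hmax L (Finset.mem_filter.2 ⟨Finset.mem_powerset.2 (hQ L hL), hL⟩)⟩

theorem Inst.theta_case (h : Inst G U ∅ A B k)
    (hB : ∀ u ∈ U, u ∈ B → ∀ v ∈ U, v ∈ B → ¬ G.Adj u v)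
    (hT : ∃ K Θ, Theta G U B K Θ) : Adm k (Val G U A α B) := by
  classical
  have hins : ∀ {K Θ}, Theta G U B K Θ → ∀ v ∈ U, v ∉ B → v ∉ K →
      ((∀ u ∈ K, G.Adj v u) ∧ ∀ u ∈ Θ, G.Adj v u) → Theta G U B (insert v K) Θ := by
    intro K Θ t v hv hvB hvK ⟨h1, h2⟩
    refine ⟨Finset.insert_subset hv t.KU, ?_, t.clq.insert h1, ?_, t.ΘU, t.ΘB, ?_, t.pos, t.le⟩
    · intro u hu
      rcases Finset.mem_insert.1 hu with rfl | hu
      · exact hvB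
      · exact t.KB u hu
    · rw [Finset.card_insert_of_notMem hvK]; have := t.two; omega
    · intro u hu
      rcases Finset.mem_insert.1 hu with rfl | hu
      · exact h2
      · exact t.adj u hu
  by_cases h2 : ∃ K, ∃ Θ, Theta G U B K Θ ∧ Θ.card = 2
  · obtain ⟨K, ⟨Θ, t, hΘ⟩, hmax⟩ := exists_max_card (U := U) (fun K hK => by
      obtain ⟨Θ, t, -⟩ := hK; exact t.KU) h2
    refine t.case_two h hΘ hB fun v hv hvB hvK hadj => ?_
    have := hmax _ ⟨Θ, hins t v hv hvB hvK hadj, hΘ⟩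
    rw [Finset.card_insert_of_notMem hvK] at this
    omega
  · obtain ⟨K, ⟨Θ, t⟩, hmax⟩ := exists_max_card (U := U) (fun K hK => by
      obtain ⟨Θ, t⟩ := hK; exact t.KU) hT
    have hΘ : Θ.card = 1 := by
      have e1 := t.pos
      have e2 := t.le
      have e3 : Θ.card ≠ 2 := fun e => h2 ⟨K, Θ, t, e⟩
      omega
    refine t.case_one h hΘ hB (fun v hv hvB hvK hadj => ?_) (fun v hv hvB hvΘ hadj => ?_)
    · have := hmax _ ⟨Θ, hins t v hv hvB hvK hadj⟩
      rw [Finset.card_insert_of_notMem hvK] at this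
      omega
    · have hc : (insert v Θ).card = 2 := by rw [Finset.card_insert_of_notMem hvΘ, hΘ]
      refine h2 ⟨K, insert v Θ, ⟨t.KU, t.KB, t.clq, t.two, Finset.insert_subset hv t.ΘU, ?_, ?_,
        by omega, by omega⟩, hc⟩
      · intro u hu
        rcases Finset.mem_insert.1 hu with rfl | hu
        · exact hvB
        · exact t.ΘB u hu
      · intro u hu w hw
        rcases Finset.mem_insert.1 hw with rfl | hw
        · exact (hadj u hu).symm
        · exact t.adj u hu w hw

theorem Inst.indep_case (h : Inst G U ∅ A B k)
    (hB : ∀ u ∈ U, u ∈ B → ∀ v ∈ U, v ∈ B → ¬ G.Adj u v) : Adm k (Val G U A α B) := by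
  classical
  by_cases hT : ∃ K Θ, Theta G U B K Θ
  · exact h.theta_case hB hT
  have htri : ∀ b ∈ U, b ∈ B → ∀ u ∈ U, ∀ v ∈ U, G.Adj u b → G.Adj v b → ¬ G.Adj u v := by
    intro b hb hbB u hu v hv hub hvb huv
    refine hT ⟨{u, v}, {b}, ?_, ?_, ?_, ?_, ?_, ?_, ?_, by simp, by simp⟩
    · simp [Finset.insert_subset_iff, hu, hv]
    · simp only [Finset.mem_insert, Finset.mem_singleton]
      rintro w (rfl | rfl) hwB
      · exact hB w hu hwB b hb hbB hub
      · exact hB w hv hwB b hb hbB hvb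
    · simp only [Clq, Finset.mem_insert, Finset.mem_singleton]
      rintro x (rfl | rfl) y (rfl | rfl) hxy
      · exact absurd rfl hxy
      · exact huv
      · exact huv.symm
      · exact absurd rfl hxy
    · rw [Finset.card_pair huv.ne]
    · simpa using hb
    · simpa using hbB
    · simp only [Finset.mem_insert, Finset.mem_singleton]
      rintro x (rfl | rfl) y rfl
      · exact hub
      · exact hvb
  by_cases hone : ∀ W ⊆ U, (∀ v ∈ W, v ∈ B) → ∀ v ∈ U, v ∉ B → dg G W v ≤ 1
  · exact h.single_case hB hone
  push Not at hone
  obtain ⟨W, hWU, hWB, v₀, hv₀, hv₀B, hdg⟩ := hone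
  let T : Finset V → Finset V := fun P => U.filter fun v => v ∈ B ∧ ∀ p ∈ P, G.Adj v p
  obtain ⟨P, ⟨hPU, hPB, hPne, hPT⟩, hmax⟩ := exists_max_card (U := U)
    (Q := fun P => P ⊆ U ∧ (∀ v ∈ P, v ∉ B) ∧ P.Nonempty ∧ P.card + 1 ≤ (T P).card)
    (fun K hK => hK.1) ⟨{v₀}, by simpa using hv₀, by simpa using hv₀B, by simp, by
      refine le_trans ?_ (Finset.card_le_card (s := W.filter (G.Adj v₀ ·)) fun u hu => ?_)
      · rw [Finset.card_singleton]; exact hdg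
      · rw [Finset.mem_filter] at hu
        exact Finset.mem_filter.2 ⟨hWU hu.1, hWB u hu.1, by simpa using hu.2.symm⟩⟩
  have hTm : ∀ {P v}, v ∈ T P ↔ v ∈ U ∧ v ∈ B ∧ ∀ p ∈ P, G.Adj v p := Finset.mem_filter
  refine Bip.case (P := P) (T := T P) h ⟨hPU, hPB, hPne, Finset.filter_subset _ _,
    fun v hv => (hTm.1 hv).2.1, fun p hp t ht => ((hTm.1 ht).2.2 p hp).symm,
    fun v hv hvB hadj => hTm.2 ⟨hv, hvB, hadj⟩, hPT, fun v hv hvB hvP => ?_⟩ hB htri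
  by_contra! hcon
  have hins : (insert v P).card = P.card + 1 := Finset.card_insert_of_notMem hvP
  have := hmax (insert v P) ⟨Finset.insert_subset hv hPU, ?_, by simp, ?_⟩
  · omega
  · intro u hu
    rcases Finset.mem_insert.1 hu with rfl | hu
    · exact hvB
    · exact hPB u hu
  · rw [hins]
    refine le_trans hcon (Finset.card_le_card fun u hu => ?_)
    rw [Finset.mem_filter, hTm] at hu
    refine hTm.2 ⟨hu.1.1, hu.1.2.1, fun p hp => ?_⟩
    rcases Finset.mem_insert.1 hp with rfl | hp
    · exact hu.2.symm
    · exact hu.1.2.2 p hp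

theorem Inst.adm (h : Inst G U Δ A B k)
    (hδ : ∀ δ, Δ = {δ} → ∃ b ∈ U, b ∈ B ∧ G.Adj δ b) : Adm k (Val G U A α B) := by
  classical
  by_cases hK : ∃ K, K ⊆ U ∧ Clq G K ∧ (∀ v ∈ K, v ∈ B) ∧ Δ ⊆ K ∧ 2 ≤ K.card
  · obtain ⟨K, ⟨h1, h2, h3, h4, h5⟩, hmax⟩ := exists_max_card (U := U) (fun K hK => hK.1) hK
    refine h.clique_case h2 h1 h3 h4 h5 fun v hv hvB hadj => ?_
    by_contra hvK
    have hc := Finset.card_insert_of_notMem hvK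
    have := hmax (insert v K) ⟨Finset.insert_subset hv h1, h2.insert hadj, ?_,
      h4.trans (Finset.subset_insert _ _), by omega⟩
    · omega
    · intro u hu
      rcases Finset.mem_insert.1 hu with rfl | hu
      · exact hvB
      · exact h3 u hu
  · have hpair : ∀ u ∈ U, u ∈ B → ∀ v ∈ U, v ∈ B → G.Adj u v → ¬ Δ ⊆ {u, v} := by
      intro u hu huB v hv hvB huv hΔ
      refine hK ⟨{u, v}, ?_, ?_, ?_, hΔ, ?_⟩
      · simp [Finset.insert_subset_iff, hu, hv]
      · simp only [Clq, Finset.mem_insert, Finset.mem_singleton]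
        rintro x (rfl | rfl) y (rfl | rfl) hxy
        · exact absurd rfl hxy
        · exact huv
        · exact huv.symm
        · exact absurd rfl hxy
      · simp [huB, hvB]
      · rw [Finset.card_pair huv.ne]
    have hΔ : Δ = ∅ := by
      by_contra hne
      have h1 := Finset.card_pos.2 (Finset.nonempty_iff_ne_empty.2 hne)
      by_cases h2 : 2 ≤ Δ.card
      · exact hK ⟨Δ, h.sub, h.clq, h.subB, subset_rfl, h2⟩
      · obtain ⟨δ, rfl⟩ := Finset.card_eq_one.1 (by omega : Δ.card = 1)
        obtain ⟨b, hb, hbB, hδb⟩ := hδ δ rfl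
        exact hpair δ (h.sub (by simp)) (h.subB δ (by simp)) b hb hbB hδb (by simp)
    subst hΔ
    exact h.indep_case fun u hu huB v hv hvB huv => hpair u hu huB v hv hvB huv (by simp)

theorem fConc (U : Finset V) : FConc G U := by
  classical
  induction hn : U.card using Nat.strong_induction_on generalizing U with
  | _ n ih =>
  subst hn
  have IH : ∀ C : Finset V, C.card < U.card → FConc G C := fun C hC => ih _ hC C rfl
  clear ih
  intro Δ A α B k hg hne hΔU hclq hΔB hconst hdeg
  obtain ⟨v₀, hv₀⟩ := hne
  have hv₀' := Finset.mem_sdiff.1 hv₀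
  obtain ⟨E, hE, hvE, hEcl, hEcon⟩ := exists_comp (G := G) hv₀'.1
  by_cases hk0 : k = 0
  · exact ⟨0, 1, .inl rfl, fun i hi => by omega⟩
  by_cases hk1 : k = 1
  · obtain ⟨⟨a, ha, haA⟩, b, hb, hbB⟩ := hg.c1 E hE ⟨v₀, hvE⟩ hEcl
    obtain ⟨l, hl⟩ := hEcon.path ha hb
    refine ⟨α a + l, 1, .inl rfl, fun i hi => ?_⟩
    obtain rfl : i = 0 := by omega
    exact ⟨a, haA, b, hbB, l, hl.mono hE, rfl⟩
  have hk : 2 ≤ k := by omega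
  replace hdeg := hdeg hk
  by_cases hEU : E = U
  swap
  · have hΔE : Δ ∩ E = ∅ ∨ Δ ∩ E = Δ := by
      by_cases hd : (Δ ∩ E).Nonempty
      · right
        obtain ⟨δ, hδ⟩ := hd
        rw [Finset.mem_inter] at hδ
        refine Finset.inter_eq_left.2 fun x hx => ?_
        by_cases e : δ = x
        · exact e ▸ hδ.2
        · exact hEcl δ hδ.2 x (hΔU hx) (hclq δ hδ.1 x hx e)
      · left; exact Finset.not_nonempty_iff_eq_empty.1 hd
    have key := IH E (Finset.card_lt_card (hE.ssubset_of_ne hEU)) (Δ ∩ E) A α B k ?_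
      ⟨v₀, by simp [hvE, hv₀'.2]⟩ Finset.inter_subset_right
      (hclq.subset Finset.inter_subset_left) (fun v hv => hΔB v (Finset.mem_inter.1 hv).1) ?_ ?_
    · refine key.mono le_rfl ?_
      rintro n ⟨a, ha, b, hb, l, hl, rfl⟩
      exact ⟨a, ha, b, hb, l, hl.mono hE, rfl⟩
    · constructor
      · exact fun D hD hne hcl => hg.c1 D (hD.trans hE) hne (hEcl.trans hcl hD)
      · intro b D hD hne hb hX
        exact hg.c2 b D (hD.trans hE) hne hb fun v hv u hu hvu =>
          hX v hv u (hEcl v (hD hv) u hu hvu) hvu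
    · rcases hΔE with h | h
      · simp [h]
      · rwa [h]
    · intro _ v hv
      simp only [Finset.mem_sdiff, Finset.mem_inter, not_and] at hv
      have h1 := hdeg v (Finset.mem_sdiff.2 ⟨hE hv.1, fun h => hv.2 h hv.1⟩)
      have h2 : dg G U v ≤ dg G E v := dg_le_of fun u hu ha => hEcl v hv.1 u hu ha
      omega
  subst hEU
  by_cases hstr : ∀ b, ∀ D ⊆ E, Disjoint D Δ → StrongFor G E A B D b
  swap
  · unfold StrongFor at hstr
    push Not at hstr
    obtain ⟨b, D, hD, hdΔ, hDne, hbD, hX, hmiss⟩ := hstr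
    have hbE : b ∈ E := by
      by_contra hb
      have := hg.c1 D hD hDne (hX.clo hb)
      exact hmiss this.1 this.2
    have hcard : D.card < E.card := Finset.card_lt_card ⟨hD, fun h => hbD (h hbE)⟩
    have hdegD : ∀ v ∈ D, k + 1 ≤ dg G D v + ind (nbs G {b}) v + ind A v + ind B v := by
      intro v hv
      have h1 := hdeg v (Finset.mem_sdiff.2 ⟨hD hv, Finset.disjoint_left.1 hdΔ hv⟩)
      have h2 : dg G E v ≤ dg G D v + dg G {b} v :=
        dg_le_add fun u hu ha => by simpa using hX v hv u hu ha
      have h3 := dg_singleton_le (G := G) b v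
      omega
    have hclo : ∀ D' ⊆ D, Clo G D D' → ¬ Meets D' (nbs G {b}) → Clo G E D' := by
      intro D' hD' hcl hn v hv u hu hvu
      rcases hX v (hD' hv) u hu hvu with h1 | rfl
      · exact hcl v hv u h1 hvu
      · exact absurd ⟨v, hv, mem_nbs_singleton.2 hvu⟩ hn
    have hcloX : ∀ D' ⊆ D, Clo G D D' → CloX G E D' b := by
      intro D' hD' hcl v hv u hu hvu
      rcases hX v (hD' hv) u hu hvu with h1 | h1
      · exact .inl (hcl v hv u h1 hvu)
      · exact .inr h1
    have hcloX' : ∀ b', ∀ D' ⊆ D, CloX G D D' b' → ¬ Meets D' (nbs G {b}) → CloX G E D' b' := by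
      intro b' D' hD' hcl hn v hv u hu hvu
      rcases hX v (hD' hv) u hu hvu with h1 | rfl
      · exact hcl v hv u h1 hvu
      · exact absurd ⟨v, hv, mem_nbs_singleton.2 hvu⟩ hn
    have hsub : ∀ {D' : Finset V} {S : Set V}, D' ⊆ D → Meets D' S → Meets D S :=
      fun hs h => h.imp fun x hx => ⟨hs hx.1, hx.2⟩
    have hE0 := hg.c1 E subset_rfl ⟨v₀, hvE⟩ (Clo.self E)
    by_cases hDA : Meets D A
    · have hDB := hmiss hDA
      obtain ⟨b', hb', r, hr⟩ := link hEcon hD hbE hbD hX hE0.2 hDB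
      have key := IH D hcard ∅ A α (nbs G {b}) k ?_ (by simpa using hDne) (by simp)
        (by simp [Clq]) (by simp) (by simp) ?_
      · refine key.shift (r + 1) ?_
        rintro n ⟨a, ha, w, hw, l, hl, rfl⟩
        exact ⟨a, ha, b', hb', _, hl.join (mem_nbs_singleton.1 hw) hr.symm
          Finset.disjoint_sdiff hD Finset.sdiff_subset, by ring⟩
      · constructor
        · intro D' hD' hne hcl
          constructor
          · exact (hg.c2 b D' (hD'.trans hD) hne (fun h => hbD (hD' h))
              (hcloX D' hD' hcl)).resolve_right fun h => hDB (hsub hD' h)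
          · by_contra hn
            exact hDB (hsub hD' (hg.c1 D' (hD'.trans hD) hne (hclo D' hD' hcl hn)).2)
        · intro b1 D' hD' hne hb1 hX1
          by_contra! hcon
          rcases hg.c2 b1 D' (hD'.trans hD) hne hb1 (hcloX' b1 D' hD' hX1 hcon.2) with h | h
          · exact hcon.1 h
          · exact hDB (hsub hD' h)
      · intro _ v hv
        rw [Finset.sdiff_empty] at hv
        have := hdegD v hv
        have h2 : ind B v = 0 := ind_of_notMem fun h => hDB ⟨v, hv, h⟩
        omega
    · obtain ⟨a, ha, r, hr⟩ := link hEcon hD hbE hbD hX hE0.1 hDA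
      have key := IH D hcard ∅ (nbs G {b}) (fun _ => 0) B k ?_ (by simpa using hDne) (by simp)
        (by simp [Clq]) (by simp) (by simp) ?_
      · refine key.shift (α a + r + 1) ?_
        rintro n ⟨w, hw, b', hb', l, hl, rfl⟩
        exact ⟨a, ha, b', hb', _, hr.join (mem_nbs_singleton.1 hw).symm hl
          Finset.sdiff_disjoint Finset.sdiff_subset hD, by ring⟩
      · constructor
        · intro D' hD' hne hcl
          constructor
          · by_contra hn
            exact hDA (hsub hD' (hg.c1 D' (hD'.trans hD) hne (hclo D' hD' hcl hn)).1)
          · exact (hg.c2 b D' (hD'.trans hD) hne (fun h => hbD (hD' h))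
              (hcloX D' hD' hcl)).resolve_left fun h => hDA (hsub hD' h)
        · intro b1 D' hD' hne hb1 hX1
          by_contra! hcon
          rcases hg.c2 b1 D' (hD'.trans hD) hne hb1 (hcloX' b1 D' hD' hX1 hcon.1) with h | h
          · exact hDA (hsub hD' h)
          · exact hcon.2 h
      · intro _ v hv
        rw [Finset.sdiff_empty] at hv
        have := hdegD v hv
        have h2 : ind A v = 0 := ind_of_notMem fun h => hDA ⟨v, hv, h⟩
        omega
  have hinst : Inst G E Δ A B k := ⟨IH, hEcon, ⟨v₀, hv₀⟩, hclq, hΔU, hΔB, hg, hstr, hk, hdeg⟩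
  by_cases hδ : ∀ δ, Δ = {δ} → ∃ b ∈ E, b ∈ B ∧ G.Adj δ b
  · exact hinst.adm hδ
  push Not at hδ
  obtain ⟨δ, rfl, hδ⟩ := hδ
  have hδE : δ ∈ E := hΔU (by simp)
  have hδB : δ ∈ B := hΔB δ (by simp)
  have hsub := Finset.erase_subset δ E
  have hdis : ∀ D ⊆ E.erase δ, Disjoint D {δ} := fun D hD =>
    Finset.disjoint_singleton_right.2 fun h => Finset.notMem_erase δ E (hD h)
  have key := IH (E.erase δ) (Finset.card_erase_lt_of_mem hδE) ∅ {v | v ∈ B ∨ G.Adj v δ}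
    (fun v => if G.Adj v δ then 1 else 0) A k ?_ ?_ (by simp) (by simp [Clq]) (by simp)
    (by simp) ?_
  · refine key.shift (α δ) ?_
    rintro n ⟨v, hv, a, ha, l, hl, rfl⟩
    rw [hconst (by simp) δ a]
    by_cases hvδ : G.Adj v δ
    · exact ⟨a, ha, δ, hδB, l + 1, (PIn.cons hδE hvδ.symm hl).symm, by simp [hvδ]; ring⟩
    · exact ⟨a, ha, v, hv.resolve_right hvδ, l, hl.symm.mono hsub, by simp [hvδ]; ring⟩
  · have hn : ∀ D : Finset V, ¬ Meets D {v | v ∈ B ∨ G.Adj v δ} → ¬ Meets D (nbs G {δ}) := by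
      rintro D hD ⟨v, hv, hvδ⟩
      exact hD ⟨v, hv, .inr (mem_nbs_singleton.1 hvδ)⟩
    constructor
    · intro D hD hne hcl
      have := hstr δ D (hD.trans hsub) (hdis D hD) hne
        (fun h => Finset.notMem_erase δ E (hD h)) (cloX_of_erase hcl)
      exact ⟨this.2.imp fun x hx => ⟨hx.1, .inl hx.2⟩, this.1⟩
    · intro b D hD hne hb hX
      by_contra! hcon
      rcases hg.c2 b D (hD.trans hsub) hne hb (hX.of_erase (hn D hcon.1)) with h | h
      · exact hcon.2 h
      · exact hcon.1 (h.imp fun x hx => ⟨hx.1, .inl hx.2⟩)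
  · rw [Finset.sdiff_empty, Finset.erase_eq]
    exact ⟨v₀, hv₀⟩
  · intro _ v hv
    rw [Finset.sdiff_empty] at hv
    have hvE := hsub hv
    have h1 := hdeg v (by rwa [Finset.sdiff_singleton_eq_erase])
    have h2 := dg_erase_le (G := G) E δ v
    by_cases hvδ : G.Adj v δ
    · have h3 : ind {v | v ∈ B ∨ G.Adj v δ} v = 1 := ind_of_mem (.inr hvδ)
      have h4 : ind B v = 0 := ind_of_notMem fun h => hδ v hvE h hvδ.symm
      have := ind_le_one (nbs G {δ}) v
      omega
    · have h3 : ind (nbs G {δ}) v = 0 := ind_of_notMem fun h => hvδ (mem_nbs_singleton.1 h)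
      have h4 : ind B v ≤ ind {v | v ∈ B ∨ G.Adj v δ} v := by
        by_cases h' : v ∈ B
        · rw [ind_of_mem (show v ∈ {v | v ∈ B ∨ G.Adj v δ} from .inl h')]; exact ind_le_one _ _
        · rw [ind_of_notMem h']; exact Nat.zero_le _
      omega

end Main

section Parity

variable {V : Type*} [DecidableEq V] {G : SimpleGraph V} [DecidableRel G.Adj]

/-- the parity of `c` is a proper two-colouring of `U` -/
def Alt (G : SimpleGraph V) (U : Finset V) (c : V → ℕ) : Prop :=
  ∀ u ∈ U, ∀ v ∈ U, G.Adj u v → c v % 2 ≠ c u % 2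

theorem Alt.subset {U W : Finset V} {c : V → ℕ} (h : Alt G U c) (hs : W ⊆ U) : Alt G W c :=
  fun u hu v hv => h u (hs hu) v (hs hv)

theorem Alt.path {U : Finset V} {c : V → ℕ} {u v : V} {n : ℕ} (h : Alt G U c)
    (hp : PIn G U u v n) : (c u + n) % 2 = c v % 2 := by
  induction hp with
  | nil _ => rfl
  | @cons U u w v n hu a hp ih =>
    have h1 := ih (h.subset (Finset.erase_subset _ _))
    have h2 := h u hu w (Finset.mem_of_mem_erase hp.mem_left) a
    omega

theorem exists_path_of_closed_meets {U : Finset V} {S : Set V} {a : V} (ha : a ∈ U)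
    (h : ∀ D ⊆ U, a ∈ D → Clo G U D → Meets D S) : ∃ b ∈ S, ∃ r, PIn G U a b r := by
  obtain ⟨E, hE, haE, hcl, hconn⟩ := exists_comp (G := G) ha
  obtain ⟨b, hb, hbS⟩ := h E hE haE hcl
  obtain ⟨r, hr⟩ := hconn.path haE hb
  exact ⟨b, hbS, r, hr.mono hE⟩

/-- If all labelled paths from the labelled vertices to `B` have the same parity, then `U` is
bipartite, compatibly with the labels. -/
theorem exists_alt (U : Finset V) : ∀ (L : V → ℕ → Prop) (B : Set V) (π : ℕ),
    Good G U {v | ∃ n, L v n} B →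
    (∀ a n b l, L a n → b ∈ B → PIn G U a b l → (n + l) % 2 = π % 2) →
    ∃ c : V → ℕ, Alt G U c ∧ ∀ v ∈ U, ∀ n, L v n → c v % 2 = n % 2 := by
  induction U using Finset.strongInduction with
  | H U ih =>
  intro L B π hg hpar
  rcases U.eq_empty_or_nonempty with rfl | hne
  · exact ⟨fun _ => 0, fun u hu => by simp at hu, fun v hv => by simp at hv⟩
  obtain ⟨a, ha, n₀, hn₀⟩ := (hg.c1 U subset_rfl hne (Clo.self U)).1
  by_cases hB : ∀ D ⊆ U.erase a, D.Nonempty → Clo G (U.erase a) D → Meets D B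
  · obtain ⟨c, hc, hcL⟩ := ih (U.erase a) (Finset.erase_ssubset ha)
      (fun v n => L v n ∨ (G.Adj v a ∧ n = n₀ + 1)) B π (by
        constructor
        · intro D hD hDne hcl
          refine ⟨?_, hB D hD hDne hcl⟩
          by_contra hm
          refine hm ?_
          have hcl' : Clo G U D := by
            intro d hd u hu h
            by_cases e : u = a
            · subst e
              exact absurd ⟨d, hd, n₀ + 1, .inr ⟨h, rfl⟩⟩ hm
            · exact hcl d hd u (Finset.mem_erase.2 ⟨e, hu⟩) h
          obtain ⟨d, hd, n, hn⟩ := (hg.c1 D (hD.trans (Finset.erase_subset _ _)) hDne hcl').1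
          exact ⟨d, hd, n, .inl hn⟩
        · intro b D hD hDne hb hX
          by_contra! hm
          have hX' : CloX G U D b := by
            intro d hd u hu h
            by_cases e : u = a
            · subst e
              exact absurd ⟨d, hd, n₀ + 1, .inr ⟨h, rfl⟩⟩ hm.1
            · exact hX d hd u (Finset.mem_erase.2 ⟨e, hu⟩) h
          rcases hg.c2 b D (hD.trans (Finset.erase_subset _ _)) hDne hb hX' with h | h
          · obtain ⟨d, hd, n, hn⟩ := h
            exact hm.1 ⟨d, hd, n, .inl hn⟩
          · exact hm.2 h)
      (by
        rintro v n b l (hL | ⟨hva, rfl⟩) hb hp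
        · exact hpar v n b l hL hb (hp.mono (Finset.erase_subset _ _))
        · have := hpar a n₀ b (l + 1) hn₀ hb (.cons ha hva.symm hp)
          omega)
    have hnb : ∀ v ∈ U, G.Adj v a → c v % 2 = (n₀ + 1) % 2 := fun v hv h =>
      hcL v (Finset.mem_erase.2 ⟨h.ne, hv⟩) _ (.inr ⟨h, rfl⟩)
    refine ⟨Function.update c a n₀, ?_, ?_⟩
    · intro u hu v hv h
      by_cases e : u = a
      · subst e
        have := hnb v hv h.symm
        rw [Function.update_self, Function.update_of_ne h.ne']
        omega
      by_cases e' : v = a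
      · subst e'
        have := hnb u hu h
        rw [Function.update_self, Function.update_of_ne e]
        omega
      · rw [Function.update_of_ne e, Function.update_of_ne e']
        exact hc u (Finset.mem_erase.2 ⟨e, hu⟩) v (Finset.mem_erase.2 ⟨e', hv⟩) h
    · intro v hv n hn
      by_cases e : v = a
      · subst e
        obtain ⟨b, hb, r, hr⟩ := exists_path_of_closed_meets (S := B) ha
          fun D hD hvD hcl => (hg.c1 D hD ⟨v, hvD⟩ hcl).2
        have h1 := hpar v n b r hn hb hr
        have h2 := hpar v n₀ b r hn₀ hb hr
        rw [Function.update_self]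
        omega
      · rw [Function.update_of_ne e]
        exact hcL v (Finset.mem_erase.2 ⟨e, hv⟩) n (.inl hn)
  push Not at hB
  obtain ⟨D, hD, hDne, hDcl, hDB⟩ := hB
  have haD : a ∉ D := fun h => Finset.notMem_erase a U (hD h)
  have hDU : D ⊆ U := hD.trans (Finset.erase_subset _ _)
  have hDX : CloX G U D a := by
    intro d hd u hu h
    by_cases e : u = a
    · exact .inr e
    · exact .inl (hDcl d hd u (Finset.mem_erase.2 ⟨e, hu⟩) h)
  have haUD : a ∈ U \ D := Finset.mem_sdiff.2 ⟨ha, haD⟩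
  have hB' : ∀ E ⊆ U \ D, a ∈ E → Clo G (U \ D) E → Meets E B := by
    intro E hE haE hcl
    obtain ⟨b, hb, hbB⟩ := (hg.c1 (E ∪ D) (Finset.union_subset (hE.trans Finset.sdiff_subset) hDU)
      ⟨a, Finset.mem_union_left _ haE⟩ (by
        intro d hd u hu h
        by_cases huD : u ∈ D
        · exact Finset.mem_union_right _ huD
        refine Finset.mem_union_left _ ?_
        rcases Finset.mem_union.1 hd with hd | hd
        · exact hcl d hd u (Finset.mem_sdiff.2 ⟨hu, huD⟩) h
        · rcases hDX d hd u hu h with h | rfl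
          · exact absurd h huD
          · exact haE)).2
    rcases Finset.mem_union.1 hb with h | h
    · exact ⟨b, h, hbB⟩
    · exact absurd ⟨b, h, hbB⟩ hDB
  obtain ⟨b₀, hb₀, r, hr⟩ := exists_path_of_closed_meets haUD hB'
  have hr₀ := hpar a n₀ b₀ r hn₀ hb₀ (hr.mono Finset.sdiff_subset)
  have hmono : ∀ E ⊆ D, ¬ Meets E B := fun E hE ⟨x, hx, hxB⟩ => hDB ⟨x, hE hx, hxB⟩
  have hpar₁ : ∀ v n w l, L v n → G.Adj w a → PIn G D v w l →
      (n + l) % 2 = (n₀ + 1) % 2 := by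
    intro v n w l hn hw hp
    have := hpar v n b₀ _ hn hb₀ (hp.join hw hr Finset.disjoint_sdiff hDU Finset.sdiff_subset)
    omega
  have hDc1 : ∀ E ⊆ D, E.Nonempty → Clo G D E →
      Meets E {v | ∃ n, L v n} ∧ Meets E (nbs G {a}) := by
    intro E hE hEne hcl
    have hX : CloX G U E a := by
      intro d hd u hu h
      rcases hDX d (hE hd) u hu h with h' | h'
      · exact .inl (hcl d hd u h' h)
      · exact .inr h'
    refine ⟨(hg.c2 a E (hE.trans hDU) hEne (fun h => haD (hE h)) hX).resolve_right
      (hmono E hE), ?_⟩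
    by_contra hm
    refine hmono E hE (hg.c1 E (hE.trans hDU) hEne fun d hd u hu h => ?_).2
    rcases hX d hd u hu h with h' | rfl
    · exact h'
    · exact absurd ⟨d, hd, mem_nbs_singleton.2 h⟩ hm
  obtain ⟨c₁, hc₁, hcL₁⟩ := ih D (Finset.ssubset_iff_subset_ne.2 ⟨hDU, by rintro rfl; exact haD ha⟩)
    L (nbs G {a}) (n₀ + 1) ⟨hDc1, by
      intro b E hE hEne hb hX
      by_contra! hm
      refine hmono E hE ((hg.c2 b E (hE.trans hDU) hEne hb fun d hd u hu h => ?_).resolve_left hm.1)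
      rcases hDX d (hE hd) u hu h with h' | rfl
      · exact hX d hd u h' h
      · exact absurd ⟨d, hd, mem_nbs_singleton.2 h⟩ hm.2⟩
    (fun v n w l hn hw hp => hpar₁ v n w l hn (mem_nbs_singleton.1 hw) hp)
  obtain ⟨c₂, hc₂, hcL₂⟩ := ih (U \ D) (Finset.sdiff_ssubset hDU hDne) L B π (by
      constructor
      · intro E hE hEne hcl
        by_cases haE : a ∈ E
        · exact ⟨⟨a, haE, n₀, hn₀⟩, hB' E hE haE hcl⟩
        · refine hg.c1 E (hE.trans Finset.sdiff_subset) hEne fun d hd u hu h => ?_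
          by_cases huD : u ∈ D
          · rcases hDX u huD d (Finset.sdiff_subset (hE hd)) h.symm with h' | rfl
            · exact absurd h' (Finset.mem_sdiff.1 (hE hd)).2
            · exact absurd hd haE
          · exact hcl d hd u (Finset.mem_sdiff.2 ⟨hu, huD⟩) h
      · intro b E hE hEne hb hX
        by_cases haE : a ∈ E
        · exact .inl ⟨a, haE, n₀, hn₀⟩
        · refine hg.c2 b E (hE.trans Finset.sdiff_subset) hEne hb fun d hd u hu h => ?_
          by_cases huD : u ∈ D
          · rcases hDX u huD d (Finset.sdiff_subset (hE hd)) h.symm with h' | rfl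
            · exact absurd h' (Finset.mem_sdiff.1 (hE hd)).2
            · exact absurd hd haE
          · exact hX d hd u (Finset.mem_sdiff.2 ⟨hu, huD⟩) h)
    (fun v n b l hn hb hp => hpar v n b l hn hb (hp.mono Finset.sdiff_subset))
  have ha₂ := hcL₂ a haUD n₀ hn₀
  have hcross : ∀ u ∈ D, ∀ v ∈ U, v ∉ D → G.Adj u v → c₂ v % 2 ≠ c₁ u % 2 := by
    intro u hu v hv hvD h
    obtain rfl : v = a := (hDX u hu v hv h).resolve_left hvD
    obtain ⟨w, ⟨n, hn⟩, l, hl⟩ := exists_path_of_closed_meets (S := {v | ∃ n, L v n}) hu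
      fun E hE huE hcl => (hDc1 E hE ⟨u, huE⟩ hcl).1
    have h1 := hpar₁ w n u l hn h hl.symm
    have h2 := hc₁.path hl
    have h3 := hcL₁ w hl.mem_right n hn
    omega
  refine ⟨fun v => if v ∈ D then c₁ v else c₂ v, ?_, ?_⟩
  · intro u hu v hv h
    by_cases huD : u ∈ D <;> by_cases hvD : v ∈ D <;> simp only [huD, hvD, if_true, if_false]
    · exact hc₁ u huD v hvD h
    · exact hcross u huD v hv hvD h
    · exact (hcross v hvD u hu huD h.symm).symm
    · exact hc₂ u (Finset.mem_sdiff.2 ⟨hu, huD⟩) v (Finset.mem_sdiff.2 ⟨hv, hvD⟩) h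
  · intro v hv n hn
    by_cases hvD : v ∈ D <;> simp only [hvD, if_true, if_false]
    · exact hcL₁ v hvD n hn
    · exact hcL₂ v (Finset.mem_sdiff.2 ⟨hv, hvD⟩) n hn

end Parity

section Assembly

variable {V : Type*} [DecidableEq V] {G : SimpleGraph V} [DecidableRel G.Adj]

/-- `D` is a nonempty union of components of the complement of `S`, and not all of it. -/
structure CutPart (G : SimpleGraph V) (S D : Finset V) : Prop where
  nonempty : D.Nonempty
  disjoint : ∀ d ∈ D, d ∉ S
  closed : ∀ d ∈ D, ∀ u, G.Adj d u → u ∈ D ∨ u ∈ S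
  rest : ∃ v, v ∉ D ∧ v ∉ S

theorem CutPart.isVertexCut {S D : Finset V} (h : CutPart G S D) : IsVertexCut G S := by
  intro hc
  obtain ⟨d, hd⟩ := h.nonempty
  obtain ⟨v, hv, hvS⟩ := h.rest
  obtain ⟨p⟩ := hc.preconnected ⟨d, by simpa using h.disjoint d hd⟩ ⟨v, by simpa using hvS⟩
  refine hv ?_
  have key : ∀ (x y : ↥((↑S : Set V)ᶜ)) (p : (G.induce ((↑S : Set V)ᶜ)).Walk x y),
      (x : V) ∈ D → (y : V) ∈ D := by
    intro x y p
    induction p with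
    | nil => exact id
    | @cons x z y a p ih =>
      intro hx
      refine ih ((h.closed x hx z a).resolve_right ?_)
      exact fun hz => z.2 (Finset.mem_coe.2 hz)
  exact key _ _ p hd

theorem IsVertexCut.exists_sep [Fintype V] {S : Finset V} (h : IsVertexCut G S)
    (hS : ∃ v, v ∉ S) : ∃ D, CutPart G S D := by
  classical
  by_contra hno
  refine h ?_
  obtain ⟨v₀, hv₀⟩ := hS
  have : Nonempty ↥((↑S : Set V)ᶜ) := ⟨⟨v₀, by simpa using hv₀⟩⟩
  refine ⟨fun x y => ?_⟩
  by_contra hxy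
  refine hno ⟨Finset.univ.filter fun v => ∃ hv : v ∈ (↑S : Set V)ᶜ,
    (G.induce ((↑S : Set V)ᶜ)).Reachable x ⟨v, hv⟩, ⟨x, ?_⟩, ?_, ?_, y, ?_, ?_⟩
  · exact Finset.mem_filter.2 ⟨Finset.mem_univ _, x.2, .rfl⟩
  · intro d hd
    obtain ⟨-, hv, -⟩ := Finset.mem_filter.1 hd
    simpa using hv
  · intro d hd u hdu
    obtain ⟨-, hv, hr⟩ := Finset.mem_filter.1 hd
    by_cases hu : u ∈ S
    · exact .inr hu
    · have hu' : u ∈ (↑S : Set V)ᶜ := by simpa using hu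
      refine .inl (Finset.mem_filter.2 ⟨Finset.mem_univ _, hu', hr.trans ?_⟩)
      exact SimpleGraph.Adj.reachable (show (G.induce ((↑S : Set V)ᶜ)).Adj ⟨d, hv⟩ ⟨u, hu'⟩ from hdu)
  · intro hy
    obtain ⟨-, _, hr⟩ := Finset.mem_filter.1 hy
    exact hxy hr
  · exact fun hy => y.2 (Finset.mem_coe.2 hy)

theorem CutPart.compl [Fintype V] {S D : Finset V} (h : CutPart G S D) :
    CutPart G S (Finset.univ.filter fun v => v ∉ D ∧ v ∉ S) := by
  obtain ⟨v, hv⟩ := h.rest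
  obtain ⟨d, hd⟩ := h.nonempty
  refine ⟨⟨v, by simpa using hv⟩, fun u hu => ?_, fun u hu w huw => ?_, d, ?_, h.disjoint d hd⟩
  · exact (Finset.mem_filter.1 hu).2.2
  · obtain ⟨-, hu, huS⟩ := Finset.mem_filter.1 hu
    by_cases hw : w ∈ S
    · exact .inr hw
    · refine .inl (Finset.mem_filter.2 ⟨Finset.mem_univ _, fun hwD => ?_, hw⟩)
      exact (h.closed w hwD u huw.symm).elim hu huS
  · simpa using fun h' => absurd hd h'

theorem CutPart.good {S C : Finset V} (h : CutPart G S C)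
    (hmin : ∀ S' D, CutPart G S' D → S.card ≤ S'.card) {x y : V} (hx : x ∈ S) (hy : y ∈ S)
    (hxy : x ≠ y) : Good G C (nbs G {x}) (nbs G {y}) := by
  have hxC : ∀ D ⊆ C, x ∉ D := fun D hD hxD => h.disjoint x (hD hxD) hx
  have hyC : ∀ D ⊆ C, y ∉ D := fun D hD hyD => h.disjoint y (hD hyD) hy
  have key : ∀ z ∈ S, ∀ D ⊆ C, D.Nonempty → Clo G C D → Meets D (nbs G {z}) := by
    intro z hz D hD hne hcl
    by_contra hm
    have := hmin (S.erase z) D ⟨hne, fun d hd hdS => h.disjoint d (hD hd) (Finset.mem_of_mem_erase hdS),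
      fun d hd u hdu => ?_, z, fun hzD => h.disjoint z (hD hzD) hz, Finset.notMem_erase z S⟩
    · have := Finset.card_erase_lt_of_mem hz
      omega
    · rcases h.closed d (hD hd) u hdu with hu | hu
      · exact .inl (hcl d hd u hu hdu)
      · refine .inr (Finset.mem_erase.2 ⟨?_, hu⟩)
        rintro rfl
        exact hm ⟨d, hd, mem_nbs_singleton.2 hdu⟩
  refine ⟨fun D hD hne hcl => ⟨key x hx D hD hne hcl, key y hy D hD hne hcl⟩,
    fun b D hD hne hb hX => ?_⟩
  by_contra! hm
  have hxm : ∀ d ∈ D, ¬ G.Adj d x := fun d hd a => hm.1 ⟨d, hd, mem_nbs_singleton.2 a⟩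
  have hym : ∀ d ∈ D, ¬ G.Adj d y := fun d hd a => hm.2 ⟨d, hd, mem_nbs_singleton.2 a⟩
  have hcard : (insert b ((S.erase x).erase y)).card < S.card := by
    have h1 := Finset.card_insert_le b ((S.erase x).erase y)
    have h2 := Finset.card_erase_lt_of_mem (Finset.mem_erase.2 ⟨hxy.symm, hy⟩)
    have h3 := Finset.card_erase_lt_of_mem hx
    omega
  have := hmin (insert b ((S.erase x).erase y)) D ⟨hne, fun d hd hdS => ?_,
    fun d hd u hdu => ?_, ?_⟩
  · omega
  · rcases Finset.mem_insert.1 hdS with rfl | hdS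
    · exact hb hd
    · exact h.disjoint d (hD hd) (Finset.mem_of_mem_erase (Finset.mem_of_mem_erase hdS))
  · rcases h.closed d (hD hd) u hdu with hu | hu
    · rcases hX d hd u hu hdu with h' | rfl
      · exact .inl h'
      · exact .inr (Finset.mem_insert_self _ _)
    · refine .inr (Finset.mem_insert_of_mem (Finset.mem_erase.2 ⟨?_, Finset.mem_erase.2 ⟨?_, hu⟩⟩))
      · rintro rfl; exact hym d hd hdu
      · rintro rfl; exact hxm d hd hdu
  · by_cases hbx : x = b
    · refine ⟨y, hyC D hD, ?_⟩
      simp [← hbx, hxy.symm]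
    · refine ⟨x, hxC D hD, ?_⟩
      simp [hbx]

theorem CutPart.degree_le [Fintype V] {S C : Finset V} (h : CutPart G S C) {x y : V} (hx : x ∈ S)
    (hy : y ∈ S) (hxy : x ≠ y) {v : V} (hv : v ∈ C) :
    G.degree v + 2 ≤ dg G C v + ind (nbs G {x}) v + ind (nbs G {y}) v + S.card := by
  have h1 : G.degree v = dg G Finset.univ v := by
    rw [dg, ← SimpleGraph.card_neighborFinset_eq_degree]
    congr 1
    ext w
    simp
  have h2 := dg_le_add (G := G) (U := Finset.univ) (D := C) (W := S) (v := v)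
    fun u _ hu => h.closed v hv u hu
  have h3 := dg_erase_le (G := G) S x v
  have h4 := dg_erase_le (G := G) (S.erase x) y v
  have h5 := dg_le_card (G := G) ((S.erase x).erase y) v
  have h6 := Finset.card_erase_of_mem (Finset.mem_erase.2 ⟨hxy.symm, hy⟩)
  have h7 := Finset.card_erase_of_mem hx
  have h8 : 0 < ((S.erase x)).card := Finset.card_pos.2 ⟨y, Finset.mem_erase.2 ⟨hxy.symm, hy⟩⟩
  omega

theorem hasCycleLen_of_sides {C₁ C₂ : Finset V} {x y : V} {l₁ l₂ : ℕ}
    (hd : Disjoint C₁ C₂) (hx₁ : x ∉ C₁) (hx₂ : x ∉ C₂) (hy₁ : y ∉ C₁) (hy₂ : y ∉ C₂)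
    (hxy : x ≠ y) (h₁ : l₁ ∈ Val G C₁ (nbs G {x}) (fun _ => 0) (nbs G {y}))
    (h₂ : l₂ ∈ Val G C₂ (nbs G {x}) (fun _ => 0) (nbs G {y})) :
    HasCycleLen G (l₁ + l₂ + 4) := by
  obtain ⟨a₁, ha₁, b₁, hb₁, m₁, hp₁, rfl⟩ := h₁
  obtain ⟨a₂, ha₂, b₂, hb₂, m₂, hp₂, rfl⟩ := h₂
  rw [mem_nbs_singleton] at ha₁ ha₂ hb₁ hb₂
  have hq := hp₁.join hb₁ (.nil (Finset.mem_singleton_self y))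
    (Finset.disjoint_singleton_right.2 hy₁) (Finset.subset_union_left (s₂ := {y}))
    Finset.subset_union_right
  have hq' := hq.join hb₂.symm hp₂.symm (by
      rw [Finset.disjoint_union_left]
      exact ⟨hd, Finset.disjoint_singleton_left.2 hy₂⟩)
    (Finset.subset_union_left (s₂ := C₂)) Finset.subset_union_right
  have := hq'.hasCycleLen (w := x) (by omega) (by simp [hx₁, hx₂, hxy]) ha₁.symm ha₂
  rw [show 0 + m₁ + (0 + m₂) + 4 = m₁ + 0 + 1 + m₂ + 1 + 2 by omega]
  exact this

theorem even_cycles_of_odd {C : Finset V} {A B : Set V} {n : ℕ} (hn : 2 ≤ n) (hne : C.Nonempty)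
    (hg : Good G C A B) (hodd : ∀ l ∈ Val G C A (fun _ => 0) B, l % 2 = 1)
    (hdeg : ∀ v ∈ C, n + 2 ≤ dg G C v + ind A v + ind B v) :
    ∃ c, c % 2 = 0 ∧ ∀ i < n, HasCycleLen G (c + 2 * i) := by
  classical
  have hAB : ∀ v ∈ C, n + 1 ≤ dg G C v := by
    intro v hv
    have h1 := hdeg v hv
    have hA := ind_le_one A v
    have hB := ind_le_one B v
    by_cases ha : v ∈ A
    · by_cases hb : v ∈ B
      · have := hodd 0 ⟨v, ha, v, hb, 0, .nil hv, rfl⟩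
        omega
      · rw [ind_of_notMem hb] at h1; omega
    · rw [ind_of_notMem ha] at h1; omega
  obtain ⟨c, hc, -⟩ := exists_alt (G := G) C (fun v m => v ∈ A ∧ m = 0) B 1
    (by simpa using hg) (by
      rintro a m b l ⟨ha, rfl⟩ hb hp
      exact hodd _ ⟨a, ha, b, hb, l, hp, rfl⟩)
  have hlarge : ∀ D ⊆ C, ∀ v ∈ D, ∀ b, CloX G C D b → (D.erase v).Nonempty := by
    intro D hD v hv b hX
    by_contra hcon
    rw [Finset.not_nonempty_iff_eq_empty] at hcon
    have h1 := hAB v (hD hv)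
    have h2 := dg_le_add (G := G) (U := C) (D := D.erase v) (W := {b}) (v := v)
      fun u hu h => (hX v hv u hu h).imp (fun h' => Finset.mem_erase.2 ⟨h.ne', h'⟩) (by simp)
    have h3 := dg_le_card (G := G) {b} v
    have h4 := dg_le_card (G := G) (D.erase v) v
    rw [hcon, Finset.card_empty] at h4
    simp only [Finset.card_singleton, hcon] at h2 h3
    omega
  obtain ⟨b₁, hb₁⟩ := hne
  obtain ⟨D, ⟨hDC, hDne, b, hb, hbD, hX⟩, hmin⟩ := exists_minimal_of_wellFoundedLT
    (fun D : Finset V => D ⊆ C ∧ D.Nonempty ∧ ∃ b ∈ C, b ∉ D ∧ CloX G C D b)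
    ⟨C.erase b₁, Finset.erase_subset _ _, hlarge C subset_rfl b₁ hb₁ b₁ ((Clo.self C).cloX b₁), b₁,
      hb₁, Finset.notMem_erase _ _, fun d _ u hu _ => by
        by_cases e : u = b₁
        · exact .inr e
        · exact .inl (Finset.mem_erase.2 ⟨e, hu⟩)⟩
  have hmin' : ∀ E ⊆ D, E.Nonempty → ∀ v ∈ D, v ∉ E → ∀ b' ∈ C, b' ∉ E → ¬ CloX G C E b' :=
    fun E hE hEne v hv hvE b' hb' hbE hXE =>
      hvE (hmin (y := E) ⟨hE.trans hDC, hEne, b', hb', hbE, hXE⟩ hE hv)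
  obtain ⟨a₀, ha₀, hab⟩ : ∃ a₀ ∈ D, G.Adj a₀ b := by
    by_contra! hcon
    obtain ⟨v, hv⟩ := hDne
    refine hmin' (D.erase v) (Finset.erase_subset _ _) (hlarge D hDC v hv b hX) v hv
      (Finset.notMem_erase _ _) v (hDC hv) (Finset.notMem_erase _ _) fun d hd u hu h => ?_
    by_cases e : u = v
    · exact .inr e
    · rcases hX d (Finset.mem_of_mem_erase hd) u hu h with h' | rfl
      · exact .inl (Finset.mem_erase.2 ⟨e, h'⟩)
      · exact absurd h (hcon d (Finset.mem_of_mem_erase hd))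
  have hsub : D.erase a₀ ⊆ D := Finset.erase_subset _ _
  have hN : ∀ E ⊆ D.erase a₀, ∀ b', CloX G (D.erase a₀) E b' → ∀ d ∈ E, ∀ u ∈ C, G.Adj d u →
      (u ∈ E ∨ u = b') ∨ u = a₀ ∨ u = b := by
    intro E hE b' hXE d hd u hu h
    rcases hX d (hsub (hE hd)) u hu h with h' | h'
    · by_cases e : u = a₀
      · exact .inr (.inl e)
      · exact .inl (hXE d hd u (Finset.mem_erase.2 ⟨e, h'⟩) h)
    · exact .inr (.inr h')
  have haE : ∀ E ⊆ D.erase a₀, a₀ ∉ E := fun E hE h => Finset.notMem_erase a₀ D (hE h)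
  have hgood : Good G (D.erase a₀) (nbs G {a₀}) (nbs G {b}) := by
    constructor
    · intro E hE hEne hcl
      constructor
      · by_contra hm
        refine hmin' E (hE.trans hsub) hEne a₀ ha₀ (haE E hE) b hb
          (fun h => hbD (hsub (hE h))) fun d hd u hu h => ?_
        rcases hN E hE b (hcl.cloX b) d hd u hu h with h' | rfl | h'
        · exact h'
        · exact absurd ⟨d, hd, mem_nbs_singleton.2 h⟩ hm
        · exact .inr h'
      · by_contra hm
        refine hmin' E (hE.trans hsub) hEne a₀ ha₀ (haE E hE) a₀ (hDC ha₀)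
          (haE E hE) fun d hd u hu h => ?_
        rcases hN E hE a₀ (hcl.cloX a₀) d hd u hu h with h' | h' | rfl
        · exact h'
        · exact .inr h'
        · exact absurd ⟨d, hd, mem_nbs_singleton.2 h⟩ hm
    · intro b' E hE hEne hb' hXE
      by_contra! hm
      have hX' : CloX G C E b' := by
        intro d hd u hu h
        rcases hN E hE b' hXE d hd u hu h with h' | rfl | rfl
        · exact h'
        · exact absurd ⟨d, hd, mem_nbs_singleton.2 h⟩ hm.1
        · exact absurd ⟨d, hd, mem_nbs_singleton.2 h⟩ hm.2
      by_cases hbC : b' ∈ C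
      · exact hmin' E (hE.trans hsub) hEne a₀ ha₀ (haE E hE) b' hbC hb' hX'
      · exact hmin' E (hE.trans hsub) hEne a₀ ha₀ (haE E hE) a₀ (hDC ha₀) (haE E hE)
          ((hX'.clo hbC).cloX a₀)
  obtain ⟨e, d, hd, hlen⟩ := fConc (G := G) (D.erase a₀) ∅ (nbs G {a₀}) (fun _ => 0) (nbs G {b}) n
    hgood (by simpa using hlarge D hDC a₀ ha₀ b hX) (by simp) (by simp [Clq]) (by simp) (by simp)
    (fun _ v hv => by
      rw [Finset.sdiff_empty] at hv
      have h1 := hAB v (hDC (hsub hv))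
      have h2 := dg_le_add (G := G) (U := C) (D := D) (W := {b}) (v := v)
        fun u hu h => (hX v (hsub hv) u hu h).imp id (by simp)
      have h3 := dg_singleton_le (G := G) b v
      have h4 := dg_erase_le (G := G) D a₀ v
      omega)
  have hcyc : ∀ l ∈ Val G (D.erase a₀) (nbs G {a₀}) (fun _ => 0) (nbs G {b}),
      l % 2 = 1 ∧ HasCycleLen G (l + 3) := by
    rintro _ ⟨p, hp, q, hq, l, hl, rfl⟩
    rw [mem_nbs_singleton] at hp hq
    constructor
    · show (0 + l) % 2 = 1
      have h1 := hc.path (hl.mono (hsub.trans hDC))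
      have h2 := hc p (hDC (hsub hl.mem_left)) a₀ (hDC ha₀) hp
      have h3 := hc q (hDC (hsub hl.mem_right)) b hb hq
      have h4 := hc a₀ (hDC ha₀) b hb hab
      omega
    · have hj := hl.join hq (.nil (Finset.mem_singleton_self b))
        (Finset.disjoint_singleton_right.2 fun h => hbD (hsub h))
        (Finset.subset_union_left (s₂ := {b})) Finset.subset_union_right
      have := hj.hasCycleLen (w := a₀) (by omega) (by simp [hab.ne]) hp.symm hab.symm
      rw [show 0 + l + 3 = l + 0 + 1 + 2 by omega]
      exact this
  have h0 := (hcyc _ (hlen 0 (by omega))).1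
  have h1 := (hcyc _ (hlen 1 (by omega))).1
  obtain rfl : d = 2 := by omega
  refine ⟨e + 3, by omega, fun i hi => ?_⟩
  rw [show e + 3 + 2 * i = e + 2 * i + 3 by omega]
  exact (hcyc _ (hlen i hi)).2

end Assembly

section Residues

theorem exists_modEq_of_consecutive {k c : ℕ} (hk : 1 ≤ k) {Z : Set ℕ} (h : ∀ i < k, c + i ∈ Z)
    (l : ℤ) : ∃ n ∈ Z, (n : ℤ) ≡ l [ZMOD k] := by
  have hk' : (k : ℤ) ≠ 0 := by omega
  have h0 := Int.emod_nonneg (l - c) hk'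
  have h1 := Int.emod_lt_of_pos (l - c) (by omega : (0 : ℤ) < k)
  refine ⟨c + ((l - c) % k).toNat, h _ (by omega), ?_⟩
  push_cast
  rw [Int.toNat_of_nonneg h0]
  have := (Int.mod_modEq (l - c) k).add_left (c : ℤ)
  simpa using this

theorem exists_modEq_of_odd {k c : ℕ} (hk : k % 2 = 1) {Z : Set ℕ} (h : ∀ i < k, c + 2 * i ∈ Z)
    (l : ℤ) : ∃ n ∈ Z, (n : ℤ) ≡ l [ZMOD k] := by
  obtain ⟨m, rfl⟩ : ∃ m, k = 2 * m + 1 := ⟨k / 2, by omega⟩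
  obtain ⟨n, ⟨i, hi, rfl⟩, hn⟩ := exists_modEq_of_consecutive (c := 0) (k := 2 * m + 1) (by omega)
    (Z := {n | ∃ i < 2 * m + 1, n = i}) (fun i hi => ⟨i, hi, by omega⟩) ((l - c) * (m + 1))
  refine ⟨_, h n hi, ?_⟩
  obtain ⟨q, hq⟩ := hn.dvd
  refine Int.modEq_iff_dvd.2 ⟨2 * q - (l - c), ?_⟩
  push_cast at hq ⊢
  linear_combination 2 * hq

theorem exists_modEq_of_even {n c : ℕ} (hn : 1 ≤ n) (hc : c % 2 = 0) {Z : Set ℕ}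
    (h : ∀ i < n, c + 2 * i ∈ Z) {l : ℤ} (hl : Even l) :
    ∃ m ∈ Z, (m : ℤ) ≡ l [ZMOD (2 * n : ℕ)] := by
  obtain ⟨e, rfl⟩ : ∃ e, c = 2 * e := ⟨c / 2, by omega⟩
  obtain ⟨f, rfl⟩ := hl
  obtain ⟨j, ⟨i, hi, rfl⟩, hj⟩ := exists_modEq_of_consecutive (c := e) hn
    (Z := {j | ∃ i < n, j = e + i}) (fun i hi => ⟨i, hi, rfl⟩) f
  refine ⟨_, h i hi, ?_⟩
  obtain ⟨q, hq⟩ := hj.dvd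
  refine Int.modEq_iff_dvd.2 ⟨q, ?_⟩
  push_cast at hq ⊢
  linear_combination 2 * hq

/-- Sums of two sets with long arithmetic progressions hit every even residue, unless one of the
sets consists of odd numbers. -/
theorem exists_modEq_of_adm {k t : ℕ} (hk : 2 ≤ k) (ht : k + 1 ≤ 2 * t) {X Y Z : Set ℕ}
    (hX : Adm t X) (hY : Adm t Y) (hZ : ∀ x ∈ X, ∀ y ∈ Y, x + y + 4 ∈ Z) {l : ℤ} (hl : Even l)
    (hodd : k % 2 = 0 → ((∀ x ∈ X, x % 2 = 1) ∨ ∀ y ∈ Y, y % 2 = 1) →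
      ∃ n ∈ Z, (n : ℤ) ≡ l [ZMOD k]) :
    ∃ n ∈ Z, (n : ℤ) ≡ l [ZMOD k] := by
  rcases Nat.mod_two_eq_zero_or_one k with hk2 | hk2
  swap
  · obtain ⟨c, d, hd, h⟩ := hX.add hY (by omega) (by omega) 4 hZ
    rcases hd with rfl | rfl
    · exact exists_modEq_of_consecutive (c := c) (by omega)
        (fun i hi => by simpa using h i (by omega)) l
    · exact exists_modEq_of_odd hk2 (fun i hi => h i (by omega)) l
  obtain ⟨n, rfl⟩ : ∃ n, k = 2 * n := ⟨k / 2, by omega⟩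
  by_contra hno
  have hZ' : ∀ y ∈ Y, ∀ x ∈ X, y + x + 4 ∈ Z := fun y hy x hx => by
    rw [Nat.add_comm y x]; exact hZ x hx y hy
  have key : ∀ {X Y : Set ℕ}, (∀ x ∈ X, ∀ y ∈ Y, x + y + 4 ∈ Z) → ∀ c,
      (∀ i < t, c + 2 * i ∈ X) → ∀ y ∈ Y, y % 2 ≠ c % 2 := by
    intro X Y hZ c hc y hy h
    refine hno (exists_modEq_of_even (c := c + y + 4) (by omega) (by omega) (fun i hi => ?_) hl)
    rw [show c + y + 4 + 2 * i = c + 2 * i + y + 4 by omega]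
    exact hZ _ (hc i (by omega)) y hy
  obtain ⟨c, d, hd, hX⟩ := hX
  obtain ⟨c', d', hd', hY⟩ := hY
  rcases hd with rfl | rfl <;> rcases hd' with rfl | rfl
  · refine hno (exists_modEq_of_consecutive (c := c + c' + 4) (by omega) (fun i hi => ?_) l)
    by_cases h : i < t
    · have := hZ _ (hX i h) _ (hY 0 (by omega))
      rwa [show c + c' + 4 + i = c + 1 * i + (c' + 1 * 0) + 4 by omega]
    · have := hZ _ (hX (t - 1) (by omega)) _ (hY (i - (t - 1)) (by omega))
      rwa [show c + c' + 4 + i = c + 1 * (t - 1) + (c' + 1 * (i - (t - 1))) + 4 by omega]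
  · have h0 := key hZ' c' hY _ (hX 0 (by omega))
    have h1 := key hZ' c' hY _ (hX 1 (by omega))
    omega
  · have h0 := key hZ c hX _ (hY 0 (by omega))
    have h1 := key hZ c hX _ (hY 1 (by omega))
    omega
  · have h0 := key hZ c hX _ (hY 0 (by omega))
    refine hno (hodd (by omega) ?_)
    rcases Nat.mod_two_eq_zero_or_one c with h | h
    · exact .inr fun y hy => by have := key hZ c hX y hy; omega
    · exact .inl fun x hx => by have := key hZ' c' hY x hx; omega

end Residues

/-- If a 2-connected graph with minimum degree at least `k - r`
(`k ≥ 2`, `r ≥ 0`) has no `(ℓ mod k)`-cycle for some even `ℓ`, then every vertex cut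
`S` satisfies `2|S| ≥ k + 2 - 2r`. -/
theorem stmt8 {V : Type*} [Fintype V] [DecidableEq V] (G : SimpleGraph V)
    [DecidableRel G.Adj] (k r : ℕ) (hk : 2 ≤ k)
    (h2 : KConnected G 2) (hδ : ∀ v : V, k - r ≤ G.degree v)
    (hno : ∃ l : ℤ, Even l ∧ ¬ HasCycleLenMod G k l) :
    ∀ S : Finset V, IsVertexCut G S → (k : ℤ) + 2 - 2 * r ≤ 2 * S.card := by
  intro S₁ hS₁
  by_contra hlt
  have hlt' : 2 * S₁.card + 2 * r ≤ k + 1 := by omega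
  have hcard : S₁.card < Fintype.card V := by
    have hpos := h2.1
    obtain ⟨v⟩ : Nonempty V := Fintype.card_pos_iff.1 (by omega)
    have h1 := hδ v
    have h3 := G.degree_lt_card_verts v
    omega
  obtain ⟨D₁, hD₁⟩ := hS₁.exists_sep (by
    by_contra! h
    rw [(Finset.eq_univ_iff_forall.2 h), Finset.card_univ] at hcard
    omega)
  obtain ⟨S, ⟨D, hD⟩, hmin₀⟩ := exists_minimalFor_of_wellFoundedLT
    (fun S : Finset V => ∃ D, CutPart G S D) Finset.card ⟨S₁, D₁, hD₁⟩
  have hmin : ∀ S' D, CutPart G S' D → S.card ≤ S'.card := fun S' D h =>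
    (le_total S.card S'.card).elim id fun h' => hmin₀ ⟨D, h⟩ h'
  have hle := hmin S₁ D₁ hD₁
  have htwo : 1 < S.card := by
    by_contra h
    exact hD.isVertexCut (h2.2 S (by omega))
  obtain ⟨x, hx, y, hy, hxy⟩ := Finset.one_lt_card.1 htwo
  obtain ⟨t, ht⟩ : ∃ t, t + r + S.card = k + 1 := ⟨k + 1 - r - S.card, by omega⟩
  have hdeg : ∀ C, CutPart G S C → ∀ v ∈ C,
      t + 1 ≤ dg G C v + ind (nbs G {x}) v + ind (nbs G {y}) v := by
    intro C hC v hv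
    have h1 := hC.degree_le hx hy hxy hv
    have h3 := hδ v
    omega
  have hadm : ∀ C, CutPart G S C → Adm t (Val G C (nbs G {x}) (fun _ => 0) (nbs G {y})) :=
    fun C hC => fConc C ∅ _ _ _ t (hC.good hmin hx hy hxy) (by simpa using hC.nonempty) (by simp)
      (by simp [Clq]) (by simp) (by simp) (fun _ v hv => hdeg C hC v (by simpa using hv))
  obtain ⟨l, hl, hl'⟩ := hno
  have hD' := hD.compl
  have hnot : ∀ C, CutPart G S C → ∀ z ∈ S, z ∉ C := fun C hC z hz hzC => hC.disjoint z hzC hz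
  refine hl' (exists_modEq_of_adm (t := t) hk (by omega) (hadm D hD) (hadm _ hD')
    (Z := {n | HasCycleLen G n})
    (fun l₁ h₁ l₂ h₂ => hasCycleLen_of_sides ?_ (hnot _ hD x hx) (hnot _ hD' x hx)
      (hnot _ hD y hy) (hnot _ hD' y hy) hxy h₁ h₂) hl fun hk2 hodd => ?_)
  · refine Finset.disjoint_left.2 fun v hv hv' => ?_
    exact (Finset.mem_filter.1 hv').2.1 hv
  obtain ⟨n, rfl⟩ : ∃ n, k = 2 * n := ⟨k / 2, by omega⟩
  have key : ∀ C, CutPart G S C →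
      (∀ l ∈ Val G C (nbs G {x}) (fun _ => 0) (nbs G {y}), l % 2 = 1) →
      ∃ m ∈ {n | HasCycleLen G n}, (m : ℤ) ≡ l [ZMOD (2 * n : ℕ)] := by
    intro C hC hodd
    obtain ⟨c, hc, hcyc⟩ := even_cycles_of_odd (n := n) (by omega) hC.nonempty
      (hC.good hmin hx hy hxy) hodd (fun v hv => by have := hdeg C hC v hv; omega)
    exact exists_modEq_of_even (by omega) hc hcyc hl
  exact hodd.elim (key D hD) (key _ hD')
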